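/- arXiv:1907.02004 — 2 statements merged into one kernel-verified Lean document; each statement's English description precedes it below -/
import Mathlib

section
/- Let k ≥ 3, let n be divisible by k with n ≥ 2k, and assume it is not the case that n = 8 and k = 4. Let G be a balanced k-partite graph on n vertices. If G is 2-connected and δ(G) ≥ ⌈n/2⌉ + ⌊(n+2)/(2·⌈(k+1)/2⌉)⌋ − n/k, then every longest cycle of G is strongly dominating. -/
open SimpleGraph Finset

/-- `G` is a balanced `k`-partite graph: the vertex set can be partitioned into `k` parts,
each of size `|V|/k`, such that every edge joins vertices in different parts. -/
def IsBalancedKPartite {V : Type*} [Fintype V] [DecidableEq V]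
    (G : SimpleGraph V) (k : ℕ) : Prop :=
  ∃ P : V → Fin k,
    (∀ i : Fin k, (Finset.univ.filter fun v => P v = i).card = Fintype.card V / k) ∧
    (∀ u v : V, G.Adj u v → P u ≠ P v)

/-- The degree bound `⌈n/2⌉ + ⌊(n+2)/(2⌈(k+1)/2⌉)⌋ − n/k`, as a rational number. -/
def degBound (n k : ℕ) : ℚ :=
  (⌈(n : ℚ) / 2⌉ : ℚ) + (⌊((n : ℚ) + 2) / (2 * (⌈((k : ℚ) + 1) / 2⌉ : ℚ))⌋ : ℚ) - (n : ℚ) / k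

/-- `G` is 2-connected: it has at least 3 vertices and remains connected after the
deletion of any single vertex. -/
def TwoConnected {V : Type*} [Fintype V] (G : SimpleGraph V) : Prop :=
  3 ≤ Fintype.card V ∧ ∀ v : V, (G.induce {w | w ≠ v}).Connected

/-- A cycle `p` in `G` is strongly dominating if the vertices off the cycle form an
independent set, and no two vertices of the union of the neighbourhoods of the off-cycle
vertices appear consecutively on the cycle. -/
def IsStronglyDominating {V : Type*} (G : SimpleGraph V) {v : V} (p : G.Walk v v) : Prop :=
  (∀ a b : V, a ∉ p.support → b ∉ p.support → ¬ G.Adj a b) ∧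
  (∀ a b : V, (∃ u, u ∉ p.support ∧ G.Adj u a) → (∃ u, u ∉ p.support ∧ G.Adj u b) →
    s(a, b) ∉ p.edges)

/-- `l` lists the vertices of a path of `G` from `x` to `y`, in order. -/
structure IsListPath {V : Type*} (G : SimpleGraph V) (l : List V) (x y : V) : Prop where
  nodup : l.Nodup
  chain : l.IsChain G.Adj
  head : l.head? = some x
  last : l.getLast? = some y

/-- `b` can be reached from `a` in `G` by edges with both ends in `S`. -/
def ReachIn {V : Type*} (G : SimpleGraph V) (S : Set V) : V → V → Prop :=
  Relation.ReflTransGen fun a b => G.Adj a b ∧ a ∈ S ∧ b ∈ S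

namespace IsListPath

variable {V : Type*} {G : SimpleGraph V} {l l₁ l₂ : List V} {x y z w : V}

theorem singleton (x : V) : IsListPath G [x] x x := ⟨by simp, by simp, rfl, rfl⟩

theorem ne_nil (h : IsListPath G l x y) : l ≠ [] := by
  rintro rfl; simpa using h.head

theorem length_pos (h : IsListPath G l x y) : 0 < l.length :=
  List.length_pos_iff.2 h.ne_nil

theorem head_mem (h : IsListPath G l x y) : x ∈ l := List.mem_of_mem_head? h.head

theorem last_mem (h : IsListPath G l x y) : y ∈ l := List.mem_of_mem_getLast? h.last

theorem reverse (h : IsListPath G l x y) : IsListPath G l.reverse y x where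
  nodup := List.nodup_reverse.2 h.nodup
  chain := List.isChain_reverse.2 (h.chain.imp fun _ _ e => e.symm)
  head := by simpa using h.last
  last := by simpa using h.head

theorem append (h₁ : IsListPath G l₁ x y) (h₂ : IsListPath G l₂ z w) (e : G.Adj y z)
    (hd : ∀ v ∈ l₁, v ∉ l₂) : IsListPath G (l₁ ++ l₂) x w where
  nodup := List.nodup_append'.2 ⟨h₁.nodup, h₂.nodup, fun v hv hv' => hd v hv hv'⟩
  chain := List.isChain_append.2 ⟨h₁.chain, h₂.chain, by
    rw [h₁.last, h₂.head]; simpa using e⟩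
  head := by simp [List.head?_append, h₁.head]
  last := by simp [List.getLast?_append, h₂.last]

theorem cons (h : IsListPath G l y z) (e : G.Adj x y) (hx : x ∉ l) :
    IsListPath G (x :: l) x z :=
  (singleton x).append h e (by simpa using hx)

theorem exists_eq_cons (h : IsListPath G l x y) (hne : x ≠ y) :
    ∃ z l', l = x :: l' ∧ G.Adj x z ∧ IsListPath G l' z y := by
  obtain ⟨hn, hc, hh, hl⟩ := h
  rcases l with _ | ⟨a, _ | ⟨b, l⟩⟩
  · simp at hh
  · simp_all
  · obtain rfl : a = x := by simpa using hh
    rw [List.isChain_cons_cons] at hc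
    exact ⟨b, b :: l, rfl, hc.1, (List.nodup_cons.1 hn).2, hc.2, rfl, by simpa using hl⟩

theorem exists_eq_concat (h : IsListPath G l x y) (hne : x ≠ y) :
    ∃ z l', l = l' ++ [y] ∧ G.Adj z y ∧ IsListPath G l' x z := by
  obtain ⟨z, l', e, ha, hp⟩ := h.reverse.exists_eq_cons hne.symm
  refine ⟨z, l'.reverse, ?_, ha.symm, hp.reverse⟩
  rw [← List.reverse_reverse l, e]; simp

/-- A path from a neighbour of `x`, extended by `x` or cut off at `x`. -/
theorem exists_cons_of_adj (h : IsListPath G l y z) (e : G.Adj x y) :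
    ∃ l', IsListPath G l' x z ∧ ∀ v ∈ l', v = x ∨ v ∈ l := by
  by_cases hx : x ∈ l
  · obtain ⟨s, t, rfl⟩ := List.append_of_mem hx
    refine ⟨x :: t, ⟨(List.nodup_append'.1 h.nodup).2.1, (List.isChain_append.1 h.chain).2.1,
      rfl, ?_⟩, fun v hv => Or.inr (List.mem_append_right _ hv)⟩
    have := h.last
    rw [List.getLast?_append] at this
    simpa using this
  · exact ⟨x :: l, h.cons e hx, fun v hv => by simpa using hv⟩

end IsListPath

namespace ReachIn

variable {V : Type*} {G : SimpleGraph V} {S T : Set V} {a b c : V}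

theorem refl (a : V) : ReachIn G S a a := Relation.ReflTransGen.refl

theorem trans (h : ReachIn G S a b) (h' : ReachIn G S b c) : ReachIn G S a c :=
  Relation.ReflTransGen.trans h h'

theorem of_adj (h : G.Adj a b) (ha : a ∈ S) (hb : b ∈ S) : ReachIn G S a b :=
  Relation.ReflTransGen.single ⟨h, ha, hb⟩

theorem symm (h : ReachIn G S a b) : ReachIn G S b a := by
  induction h with
  | refl => exact .refl _
  | tail _ h ih => exact (of_adj h.1.symm h.2.2 h.2.1).trans ih

theorem mono (h : ReachIn G S a b) (hST : S ⊆ T) : ReachIn G T a b := by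
  induction h with
  | refl => exact .refl _
  | tail _ h ih => exact ih.trans (of_adj h.1 (hST h.2.1) (hST h.2.2))

/-- A set closed under the steps of `ReachIn` contains everything reached from it. -/
theorem mem_of_closed (h : ReachIn G S a b) (Z : Set V) (ha : a ∈ Z)
    (hZ : ∀ u ∈ Z, u ∈ S → ∀ w ∈ S, G.Adj u w → w ∈ Z) : b ∈ Z := by
  induction h with
  | refl => exact ha
  | tail _ h ih => exact hZ _ ih h.2.1 _ h.2.2 h.1

theorem mem (h : ReachIn G S a b) (ha : a ∈ S) : b ∈ S :=
  h.mem_of_closed S ha fun _ _ _ _ hw _ => hw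

theorem exists_isListPath (h : ReachIn G S a b) (hb : b ∈ S) :
    ∃ l, IsListPath G l a b ∧ ∀ v ∈ l, v ∈ S := by
  induction h using Relation.ReflTransGen.head_induction_on with
  | refl => exact ⟨[b], .singleton b, by simpa using hb⟩
  | head h _ ih =>
    obtain ⟨l, hl, hS⟩ := ih
    obtain ⟨l', hl', hS'⟩ := hl.exists_cons_of_adj h.1
    refine ⟨l', hl', fun v hv => ?_⟩
    rcases hS' v hv with rfl | hv
    · exact h.2.1
    · exact hS v hv

end ReachIn

/-- A rooted set whose vertices, after the deletion of any vertex `v`, can still reach one of the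
roots `x`, `y`, and whose other vertices have degree at least `d` inside the set, contains a path
between the roots with at least `d + 1` vertices. -/
theorem exists_isListPath_of_le_degree {V : Type*} [Finite V] (G : SimpleGraph V) (d : ℕ) :
    ∀ (S : Set V) (x y : V), x ∈ S → y ∈ S → x ≠ y → ReachIn G S x y →
      (2 ≤ d → ∃ z ∈ S, z ≠ x ∧ z ≠ y) →
      (∀ v ∈ S, ∀ w ∈ S, w ≠ v → ReachIn G (S \ {v}) w x ∨ ReachIn G (S \ {v}) w y) →
      (∀ w ∈ S, w ≠ x → w ≠ y → d ≤ (S ∩ G.neighborSet w).ncard) →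
      ∃ l, IsListPath G l x y ∧ (∀ v ∈ l, v ∈ S) ∧ d + 1 ≤ l.length := by
  induction d with
  | zero =>
    intro S x y hx hy hxy hr _ _ _
    obtain ⟨l, hl, hS⟩ := hr.exists_isListPath hy
    exact ⟨l, hl, hS, hl.length_pos⟩
  | succ d ih =>
    intro S x y hx hy hxy hr hthird hconn hdeg
    rcases Nat.eq_zero_or_pos d with rfl | hd
    · obtain ⟨l, hl, hS⟩ := hr.exists_isListPath hy
      obtain ⟨z, l', rfl, -, hl'⟩ := hl.exists_eq_cons hxy
      exact ⟨_, hl, hS, by have := hl'.length_pos; simp only [List.length_cons]; omega⟩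
    obtain ⟨z₀, hz₀, hz₀x, hz₀y⟩ := hthird (by omega)
    set T : Set V := S \ {x} with hT
    have hyT : y ∈ T := ⟨hy, hxy.symm⟩
    have hreachT : ∀ w ∈ T, ReachIn G T w y := by
      intro w hw
      rcases hconn x hx w hw.1 hw.2 with h | h
      · exact absurd rfl (h.mem hw).2
      · exact h
    let P : V → Set V → Prop := fun v K => v ∈ T ∧ K ⊆ T ∧ v ∉ K ∧ y ∉ K ∧ K.Nonempty ∧
      ∀ a ∈ K, ∀ b ∈ T, G.Adj a b → b ∈ K ∨ b = v
    have hex : ∃ m, ∃ v K, P v K ∧ K.ncard = m := by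
      refine ⟨_, y, T \ {y}, ⟨hyT, Set.sdiff_subset, by simp, by simp, ⟨z₀, ⟨hz₀, hz₀x⟩, hz₀y⟩, ?_⟩,
        rfl⟩
      intro a _ b hb _
      by_cases h : b = y
      · exact Or.inr h
      · exact Or.inl ⟨hb, h⟩
    classical
    obtain ⟨v, K, ⟨hvT, hKT, hvK, hyK, hKne, hK⟩, hKm⟩ := Nat.find_spec hex
    have hmin : ∀ v' K', P v' K' → ¬ K' ⊂ K := fun v' K' h' hlt =>
      Nat.find_min hex (hKm ▸ Set.ncard_lt_ncard hlt) ⟨v', K', h', rfl⟩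
    have hxK : x ∉ K := fun h => (hKT h).2 rfl
    have hvx : v ≠ x := hvT.2
    obtain ⟨x', hx'K, hxx'⟩ : ∃ x' ∈ K, G.Adj x x' := by
      by_contra! hno
      obtain ⟨w, hw⟩ := hKne
      have hcl : ∀ u ∈ K, u ∈ S \ {v} → ∀ w ∈ S \ {v}, G.Adj u w → w ∈ K := by
        intro u hu _ w hw h
        have hwx : w ≠ x := by rintro rfl; exact hno u hu h.symm
        rcases hK u hu w ⟨hw.1, hwx⟩ h with h | h
        · exact h
        · exact absurd h hw.2
      have hwv : w ≠ v := by rintro rfl; exact hvK hw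
      rcases hconn v hvT.1 w (hKT hw).1 hwv with h | h
      · exact hxK (h.mem_of_closed K hw hcl)
      · exact hyK (h.mem_of_closed K hw hcl)
    set S' : Set V := insert v K with hS'
    have hx'v : x' ≠ v := by rintro rfl; exact hvK hx'K
    have hreach' : ∀ a ∈ K, ReachIn G S' a v := by
      intro a ha
      by_contra hno
      have := (hreachT a (hKT ha)).mem_of_closed {a | a ∈ K ∧ ¬ ReachIn G S' a v} ⟨ha, hno⟩ (by
        rintro u ⟨hu, hnu⟩ - w hw huw
        have hwS : w ∈ S' := by
          rcases hK u hu w hw huw with h | h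
          · exact Or.inr h
          · exact Or.inl h
        have hstep : ReachIn G S' u w := .of_adj huw (Or.inr hu) hwS
        rcases hK u hu w hw huw with h | rfl
        · exact ⟨h, fun h' => hnu (hstep.trans h')⟩
        · exact absurd hstep hnu)
      exact hyK this.1
    have hconn₁ : ∀ w₀ ∈ K, ∀ a ∈ K, a ≠ w₀ → ReachIn G (S' \ {w₀}) a v := by
      intro w₀ hw₀ a ha haw
      by_contra hno
      refine hmin w₀ {a | a ∈ K ∧ a ≠ w₀ ∧ ¬ ReachIn G (S' \ {w₀}) a v}
        ⟨hKT hw₀, fun a h => hKT h.1, fun h => h.2.1 rfl, fun h => hyK h.1, ⟨a, ha, haw, hno⟩, ?_⟩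
        ⟨fun a h => h.1, fun h => (h hw₀).2.1 rfl⟩
      rintro u ⟨hu, huw, hnu⟩ b hb hub
      by_cases hbw : b = w₀
      · exact Or.inr hbw
      left
      have hbS : b ∈ S' \ {w₀} := by
        refine ⟨?_, hbw⟩
        rcases hK u hu b hb hub with h | h
        · exact Or.inr h
        · exact Or.inl h
      have hstep : ReachIn G (S' \ {w₀}) u b := .of_adj hub ⟨Or.inr hu, huw⟩ hbS
      rcases hK u hu b hb hub with h | rfl
      · exact ⟨h, hbw, fun h' => hnu (hstep.trans h')⟩
      · exact absurd hstep hnu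
    have hconn₂ : ∀ a ∈ K, ReachIn G K a x' := by
      intro a ha
      by_contra hno
      refine hmin v {a | a ∈ K ∧ ¬ ReachIn G K a x'}
        ⟨hvT, fun a h => hKT h.1, fun h => hvK h.1, fun h => hyK h.1, ⟨a, ha, hno⟩, ?_⟩
        ⟨fun a h => h.1, fun h => (h hx'K).2 (.refl _)⟩
      rintro u ⟨hu, hnu⟩ b hb hub
      rcases hK u hu b hb hub with h | h
      · exact Or.inl ⟨h, fun h' => hnu ((ReachIn.of_adj hub hu h).trans h')⟩
      · exact Or.inr h
    have hS'v : S' \ {v} = K := by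
      ext a
      simp only [hS', Set.mem_sdiff, Set.mem_insert_iff, Set.mem_singleton_iff]
      exact ⟨fun h => h.1.resolve_left h.2, fun h => ⟨Or.inr h, by rintro rfl; exact hvK h⟩⟩
    have hdeg' : ∀ w ∈ K, d ≤ (S' ∩ G.neighborSet w).ncard := by
      intro w hw
      have h1 := hdeg w (hKT hw).1 (hKT hw).2 (by rintro rfl; exact hyK hw)
      have h2 : S ∩ G.neighborSet w ⊆ insert x (S' ∩ G.neighborSet w) := by
        rintro b ⟨hb, hwb⟩
        by_cases hbx : b = x
        · exact Or.inl hbx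
        · rcases hK w hw b ⟨hb, hbx⟩ hwb with h | h
          · exact Or.inr ⟨Or.inr h, hwb⟩
          · exact Or.inr ⟨Or.inl h, hwb⟩
      have h3 := Set.ncard_le_ncard h2 (Set.toFinite _)
      have h4 := Set.ncard_insert_le x (S' ∩ G.neighborSet w)
      omega
    obtain ⟨l, hl, hlS, hld⟩ := ih S' x' v (Or.inr hx'K) (Or.inl rfl) hx'v (hreach' x' hx'K) (by
      intro hd2
      by_contra! hno
      have h1 : S' ∩ G.neighborSet x' ⊆ {v} := by
        rintro b ⟨hb, hxb⟩
        exact hno b hb (by rintro rfl; exact G.loopless.irrefl _ hxb)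
      have h2 := Set.ncard_le_ncard h1 (Set.toFinite _)
      have h3 := hdeg' x' hx'K
      rw [Set.ncard_singleton] at h2
      omega) (by
      intro v' hv' w hw hwv'
      rcases hv' with rfl | hv'
      · left
        rw [hS'v]
        exact hconn₂ w (by rcases hw with h | h; exacts [absurd h hwv', h])
      · right
        rcases hw with rfl | hw
        · exact .refl _
        · exact hconn₁ v' hv' w hw hwv') (by
      intro w hw _ hwv
      exact hdeg' w (by rcases hw with h | h; exacts [absurd h hwv, h]))
    obtain ⟨z, l₁, rfl, hzv, hl₁⟩ := hl.exists_eq_concat hx'v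
    have hl₁K : ∀ a ∈ l₁, a ∈ K := by
      intro a ha
      rcases hlS a (by simp [ha]) with rfl | h
      · exact absurd rfl ((List.nodup_append.1 hl.nodup).2.2 a ha a (by simp))
      · exact h
    have hvy : ReachIn G (T \ K) v y := by
      by_contra hno
      have := (hreachT v hvT).symm.mem_of_closed {a | a ∈ T \ K ∧ ReachIn G (T \ K) y a}
        ⟨⟨hyT, hyK⟩, .refl _⟩ (by
          rintro u ⟨hu, hyu⟩ - w hw huw
          have hwK : w ∉ K := fun h => by
            rcases hK w h u hu.1 huw.symm with h | rfl
            · exact hu.2 h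
            · exact hno hyu.symm
          exact ⟨⟨hw, hwK⟩, hyu.trans (.of_adj huw hu ⟨hw, hwK⟩)⟩)
      exact hno this.2.symm
    obtain ⟨l₂, hl₂, hl₂T⟩ := hvy.exists_isListPath ⟨hyT, hyK⟩
    have hpath := (hl₁.append hl₂ hzv fun a ha ha' => (hl₂T a ha').2 (hl₁K a ha)).cons hxx' (by
      simp only [List.mem_append, not_or]
      exact ⟨fun h => hxK (hl₁K x h), fun h => (hl₂T x h).1.2 rfl⟩)
    refine ⟨_, hpath, ?_, ?_⟩
    · intro a ha
      simp only [List.mem_cons, List.mem_append] at ha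
      rcases ha with rfl | ha | ha
      · exact hx
      · exact (hKT (hl₁K a ha)).1
      · exact (hl₂T a ha).1.1
    · have := hl₂.length_pos
      simp only [List.length_append, List.length_cons, List.length_nil] at hld ⊢
      omega

/-- `f` runs periodically around a cycle of `G` with `c` vertices, and no cycle of `G` is longer. -/
structure IsLongestCycleMap {V : Type*} (G : SimpleGraph V) (f : ℕ → V) (c : ℕ) : Prop where
  three_le : 3 ≤ c
  periodic : ∀ i, f (i + c) = f i
  adj : ∀ i, G.Adj (f i) (f (i + 1))
  inj : ∀ i j, f i = f j → i ≡ j [MOD c]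
  length_le : ∀ l x y, IsListPath G l x y → G.Adj y x → 3 ≤ l.length → l.length ≤ c

namespace IsLongestCycleMap

variable {V : Type*} {G : SimpleGraph V} {f : ℕ → V} {c : ℕ} {l : List V} {x y : V} {i j s : ℕ}

theorem shift (h : IsLongestCycleMap G f c) (s : ℕ) :
    IsLongestCycleMap G (fun i => f (s + i)) c where
  three_le := h.three_le
  periodic i := by rw [← add_assoc, h.periodic]
  adj i := h.adj (s + i)
  inj _ _ e := Nat.ModEq.add_left_cancel' s (h.inj _ _ e)
  length_le := h.length_le

theorem apply_mod (h : IsLongestCycleMap G f c) (i : ℕ) : f (i % c) = f i := by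
  have hf : Function.Periodic f c := h.periodic
  exact hf.map_mod_nat i

theorem eq_of_apply_eq (h : IsLongestCycleMap G f c) (hij : i ≤ j) (hj : j < i + c)
    (e : f i = f j) : i = j := by
  have h1 := (Nat.modEq_iff_dvd' hij).1 (h.inj _ _ e)
  have h2 := Nat.eq_zero_of_dvd_of_lt h1 (by omega)
  omega

theorem exists_lt_shift (h : IsLongestCycleMap G f c) (s i : ℕ) : ∃ j < c, f (s + j) = f i := by
  have hc : 0 < c := by have := h.three_le; omega
  have h0 := (h.shift s).apply_mod (i + (c - s % c))
  refine ⟨_, Nat.mod_lt _ hc, h0.trans ?_⟩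
  rw [← h.apply_mod i, ← h.apply_mod]
  congr 1
  have h1 := Nat.mod_lt s hc
  have h2 : s + (i + (c - s % c)) = i + c * (s / c + 1) := by
    have := Nat.mod_add_div s c
    rw [Nat.mul_add, Nat.mul_one]
    omega
  rw [h2, Nat.add_mul_mod_self_left]

theorem range_shift (h : IsLongestCycleMap G f c) (s : ℕ) :
    Set.range (fun i => f (s + i)) = Set.range f := by
  ext v
  constructor
  · rintro ⟨i, rfl⟩
    exact ⟨s + i, rfl⟩
  · rintro ⟨i, rfl⟩
    obtain ⟨j, -, hj⟩ := h.exists_lt_shift s i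
    exact ⟨j, hj⟩

theorem ncard_range (h : IsLongestCycleMap G f c) : (Set.range f).ncard = c := by
  have h1 : Set.range f = f '' (Finset.range c : Finset ℕ) := by
    ext v
    constructor
    · rintro ⟨i, rfl⟩
      obtain ⟨j, hj, e⟩ := h.exists_lt_shift 0 i
      exact ⟨j, by simpa using hj, by simpa using e⟩
    · rintro ⟨i, -, rfl⟩
      exact ⟨i, rfl⟩
  rw [h1, Set.InjOn.ncard_image, Set.ncard_coe_finset, Finset.card_range]
  intro i hi j hj e
  simp only [Finset.coe_range, Set.mem_Iio] at hi hj
  rcases le_total i j with hij | hij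
  · exact h.eq_of_apply_eq hij (by omega) e
  · exact (h.eq_of_apply_eq hij (by omega) e.symm).symm

/-- The segment of the cycle from `f i` to `f j`. -/
theorem isListPath_segment (h : IsLongestCycleMap G f c) (hij : i ≤ j) (hj : j < i + c) :
    IsListPath G ((List.range' i (j - i + 1)).map f) (f i) (f j) where
  nodup := by
    refine List.Nodup.map_on ?_ (List.nodup_range' )
    intro a ha b hb e
    simp only [List.mem_range'_1] at ha hb
    rcases le_total a b with hab | hab
    · exact h.eq_of_apply_eq hab (by omega) e
    · exact (h.eq_of_apply_eq hab (by omega) e.symm).symm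
  chain := by
    rw [List.isChain_map]
    refine (List.isChain_range' i (j - i + 1) 1).imp ?_
    rintro a b rfl
    exact h.adj a
  head := by simp [List.range'_succ]
  last := by
    have : i + (j - i) = j := by omega
    rw [List.range'_concat]
    simp [this]

/-- A path off the cycle joining `f i` to `f j` is shorter than both arcs of the cycle. -/
theorem length_add_one_le (h : IsLongestCycleMap G f c) (hl : IsListPath G l x y)
    (hoff : ∀ z ∈ l, z ∉ Set.range f) (hij : i < j) (hj : j < i + c)
    (hx : G.Adj (f i) x) (hy : G.Adj y (f j)) :
    i + l.length + 1 ≤ j ∧ j + l.length + 1 ≤ i + c := by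
  have hmem : ∀ a m, ∀ z ∈ l, z ∉ (List.range' a m).map f := by
    intro a m z hz hz'
    obtain ⟨k, -, rfl⟩ := List.mem_map.1 hz'
    exact hoff _ hz ⟨k, rfl⟩
  have hpos := hl.length_pos
  have h₁ := hl.append (h.isListPath_segment (i := j) (j := i + c) (by omega) (by omega)) hy
    (hmem _ _)
  have h₂ := hl.append (h.isListPath_segment hij.le hj).reverse hy
    (fun z hz hz' => hmem _ _ z hz (List.mem_reverse.1 hz'))
  rw [h.periodic] at h₁
  have l₁ := h.length_le _ _ _ h₁ hx
  have l₂ := h.length_le _ _ _ h₂ hx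
  simp only [List.length_append, List.length_reverse, List.length_map, List.length_range'] at l₁ l₂
  omega

/-- Neighbours on the cycle of an off-cycle vertex are not consecutive. -/
theorem not_adj_succ (h : IsLongestCycleMap G f c) (hx : x ∉ Set.range f) (hi : G.Adj x (f i)) :
    ¬ G.Adj x (f (i + 1)) := fun hi' => by
  have := h.length_add_one_le (IsListPath.singleton x) (by simpa using hx) (Nat.lt_succ_self i)
    (by have := h.three_le; omega) hi.symm hi'
  simp at this

/-- The cycle is long if some vertex has many neighbours on it and starts a long off-cycle path
that ends next to the cycle. -/
theorem two_mul_length_add_le (h : IsLongestCycleMap G f c) (hl : IsListPath G l x y)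
    (hoff : ∀ z ∈ l, z ∉ Set.range f) (hy : G.Adj y (f s))
    (hne : ((G.neighborSet x ∩ Set.range f) \ {f s}).Nonempty) :
    2 * l.length + 2 * ((G.neighborSet x ∩ Set.range f) \ {f s}).ncard ≤ c := by
  classical
  have hg := h.shift s
  have hpos : ∀ v ∈ (G.neighborSet x ∩ Set.range f) \ {f s},
      ∃ i, 1 ≤ i ∧ i < c ∧ f (s + i) = v ∧ G.Adj x v := by
    rintro _ ⟨⟨hv, k, rfl⟩, hvs⟩
    obtain ⟨j, hj, e⟩ := h.exists_lt_shift s k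
    refine ⟨j, Nat.one_le_iff_ne_zero.2 ?_, hj, e, hv⟩
    rintro rfl
    exact hvs e.symm
  set N : Finset ℕ := (Finset.Ico 1 c).filter fun i => G.Adj x (f (s + i)) with hN
  have hbound : ∀ i ∈ N, l.length + 1 ≤ i ∧ i + l.length + 1 ≤ c := by
    intro i hi
    simp only [hN, Finset.mem_filter, Finset.mem_Ico] at hi
    have := hg.length_add_one_le (i := 0) (j := i) hl.reverse
      (by rw [h.range_shift]; simpa using hoff) (by omega) (by omega) hy.symm hi.2
    simp only [List.length_reverse] at this
    omega
  have hcard : ((G.neighborSet x ∩ Set.range f) \ {f s}).ncard ≤ N.card := by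
    rw [← Set.ncard_coe_finset]
    refine (Set.ncard_le_ncard (t := (fun i => f (s + i)) '' (N : Set ℕ)) ?_
      (Set.toFinite _)).trans (Set.ncard_image_le (Set.toFinite _))
    intro v hv
    obtain ⟨i, h1, h2, rfl, h4⟩ := hpos v hv
    exact ⟨i, by simp [hN, h1, h2, h4], rfl⟩
  obtain ⟨v, hv⟩ := hne
  obtain ⟨i₀, h1, h2, rfl, h4⟩ := hpos v hv
  have hi₀ : i₀ ∈ N := by simp [hN, h1, h2, h4]
  have hdisj : Disjoint N (N.map (addRightEmbedding 1)) := by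
    rw [Finset.disjoint_left]
    intro a ha ha'
    obtain ⟨b, hb, rfl⟩ := Finset.mem_map.1 ha'
    simp only [hN, Finset.mem_filter, addRightEmbedding_apply] at ha hb
    exact h.not_adj_succ (hoff x hl.head_mem) hb.2 ha.2
  have hsub : N ∪ N.map (addRightEmbedding 1) ⊆ Finset.Icc (l.length + 1) (c - l.length) := by
    intro a ha
    simp only [Finset.mem_union, Finset.mem_map, addRightEmbedding_apply] at ha
    rw [Finset.mem_Icc]
    rcases ha with ha | ⟨b, hb, rfl⟩
    · have := hbound a ha; omega
    · have := hbound b hb; omega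
  have h5 := Finset.card_le_card hsub
  rw [Finset.card_union_of_disjoint hdisj, Finset.card_map, Nat.card_Icc] at h5
  have h6 := hbound i₀ hi₀
  omega

/-- Counting the neighbours on the cycle of both ends of an off-cycle path. -/
theorem three_mul_add_le (h : IsLongestCycleMap G f c) (hl : IsListPath G l x y)
    (hoff : ∀ z ∈ l, z ∉ Set.range f) (hlen : 2 ≤ l.length) {a : ℕ} (ha : 2 ≤ a)
    (hx : a ≤ (G.neighborSet x ∩ Set.range f).ncard)
    (hy : a ≤ (G.neighborSet y ∩ Set.range f).ncard) :
    3 * a + 2 * l.length ≤ c + 4 := by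
  classical
  have hc := h.three_le
  have hex : ∃ g, 0 < g ∧ g < c ∧ ∃ b, G.Adj y (f b) ∧ G.Adj x (f (b + g)) := by
    obtain ⟨_, hb, b, rfl⟩ := Set.nonempty_of_ncard_ne_zero
      (s := G.neighborSet y ∩ Set.range f) (by omega)
    obtain ⟨_, ⟨hv, k, rfl⟩, hvb⟩ := Set.exists_ne_of_one_lt_ncard
      (s := G.neighborSet x ∩ Set.range f) (by omega) (f b)
    obtain ⟨j, hj, e⟩ := h.exists_lt_shift b k
    refine ⟨j, Nat.pos_of_ne_zero ?_, hj, b, hb, e ▸ hv⟩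
    rintro rfl
    exact hvb e.symm
  obtain ⟨hg0, hgc, b, hyb, hxb⟩ := Nat.find_spec hex
  have hmin := fun m => Nat.find_min hex (m := m)
  set g := Nat.find hex
  set F : ℕ → V := fun i => f (b + g + i) with hF
  have hFc : IsLongestCycleMap G F c := h.shift (b + g)
  have hrange : Set.range F = Set.range f := h.range_shift (b + g)
  have hoffF : ∀ z ∈ l, z ∉ Set.range F := hrange ▸ hoff
  have hFper : ∀ i, c ≤ g + i → F i = f (b + (g + i - c)) := by
    intro i hi
    rw [hF, ← h.periodic (b + (g + i - c))]
    exact congrArg f (by omega)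
  have hxF : ∀ i < c, G.Adj x (F i) → i + g ≤ c := by
    intro i hi hxi
    by_contra hlt
    refine hmin (g + i - c) (by omega) ⟨by omega, by omega, b, hyb, ?_⟩
    rwa [← hFper i (by omega)]
  have hyF : ∀ i < c, G.Adj y (F i) → i + g ≤ c := by
    intro i hi hyi
    by_contra hlt
    refine hmin (c - i) (by omega) ⟨by omega, by omega, b + (g + i - c), ?_, ?_⟩
    · rwa [← hFper i (by omega)]
    · rwa [show b + (g + i - c) + (c - i) = b + g by omega]
  have hx0 : G.Adj x (F 0) := hxb
  have hyL : G.Adj y (F (c - g)) := by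
    rw [hFper _ (by omega)]
    rwa [show g + (c - g) - c = 0 by omega]
  have hgap : ∀ i j, i < j → j < i + c → G.Adj x (F i) → G.Adj y (F j) →
      i + l.length + 1 ≤ j ∧ j + l.length + 1 ≤ i + c := fun i j hij hj hi hj' =>
    hFc.length_add_one_le hl hoffF hij hj hi.symm hj'
  have hgap' : ∀ i j, i < j → j < i + c → G.Adj y (F i) → G.Adj x (F j) →
      i + l.length + 1 ≤ j := fun i j hij hj hi hj' => by
    have := (hFc.length_add_one_le hl.reverse (by simpa using hoffF) hij hj hi.symm hj').1
    simpa using this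
  have hex₂ : ∃ m, 0 < m ∧ ∃ i, i + m ≤ c - g ∧ G.Adj x (F i) ∧ G.Adj y (F (i + m)) :=
    ⟨c - g, by omega, 0, by omega, hx0, by simpa using hyL⟩
  obtain ⟨hm0, i, him, hxi, hyi⟩ := Nat.find_spec hex₂
  have hmin₂ := fun m => Nat.find_min hex₂ (m := m)
  set m := Nat.find hex₂
  have hxno : ∀ p, i < p → p < i + m → ¬ G.Adj x (F p) := fun p h1 h2 hp =>
    hmin₂ (i + m - p) (by omega) ⟨by omega, p, by omega, hp,
      by rwa [show p + (i + m - p) = i + m by omega]⟩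
  have hyno : ∀ p, i < p → p < i + m → ¬ G.Adj y (F p) := fun p h1 h2 hp =>
    hmin₂ (p - i) (by omega) ⟨by omega, i, by omega, hxi,
      by rwa [show i + (p - i) = p by omega]⟩
  have hm := (hgap i (i + m) (by omega) (by omega) hxi hyi).1
  have hL := (hgap 0 (c - g) (by omega) (by omega) hx0 hyL).2
  let N : V → Finset ℕ := fun z => (Finset.range c).filter fun i => G.Adj z (F i)
  have hNmem : ∀ z i, i ∈ N z ↔ i < c ∧ G.Adj z (F i) := by simp [N]
  have hNcard : ∀ z, a ≤ (G.neighborSet z ∩ Set.range f).ncard → a ≤ (N z).card := by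
    intro z hz
    rw [← Set.ncard_coe_finset]
    refine hz.trans ((Set.ncard_le_ncard (t := F '' (N z : Set ℕ)) ?_
      (Set.toFinite _)).trans (Set.ncard_image_le (Set.toFinite _)))
    rintro _ ⟨hv, k, rfl⟩
    obtain ⟨j, hj, e⟩ := h.exists_lt_shift (b + g) k
    refine ⟨j, ?_, e⟩
    rw [Finset.mem_coe, hNmem]
    exact ⟨hj, show G.Adj z (f _) by rwa [e]⟩
  have hA := hNcard x hx
  have hB := hNcard y hy
  have hyoff : y ∉ Set.range F := hoffF y hl.last_mem
  set B₁ := (N y).map (addRightEmbedding 1) with hB₁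
  set B₂ := (N y).map (addRightEmbedding 2) with hB₂
  have hd₁ : Disjoint (N x) B₁ := by
    rw [Finset.disjoint_left]
    intro p hp hp'
    obtain ⟨q, hq, rfl⟩ := Finset.mem_map.1 hp'
    rw [hNmem] at hp hq
    have := hgap' q (q + 1) (by omega) (by omega) hq.2 hp.2
    omega
  have hd₂ : Disjoint (N x ∪ B₁) B₂ := by
    rw [Finset.disjoint_left]
    intro p hp hp'
    obtain ⟨q, hq, rfl⟩ := Finset.mem_map.1 hp'
    rcases Finset.mem_union.1 hp with hp | hp
    · rw [hNmem] at hp hq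
      have := hgap' q (q + 2) (by omega) (by omega) hq.2 hp.2
      omega
    · obtain ⟨q', hq', e⟩ := Finset.mem_map.1 hp
      simp only [addRightEmbedding_apply] at e
      obtain rfl : q' = q + 1 := by omega
      exact hFc.not_adj_succ hyoff ((hNmem _ _).1 hq).2 ((hNmem _ _).1 hq').2
  have hd₃ : Disjoint (N x ∪ B₁ ∪ B₂) (Finset.Ico (i + 3) (i + m)) := by
    rw [Finset.disjoint_left]
    intro p hp hp'
    rw [Finset.mem_Ico] at hp'
    simp only [Finset.mem_union, hB₁, hB₂, Finset.mem_map, addRightEmbedding_apply] at hp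
    rcases hp with (hp | ⟨q, hq, rfl⟩) | ⟨q, hq, rfl⟩
    · exact hxno p (by omega) (by omega) ((hNmem _ _).1 hp).2
    · exact hyno q (by omega) (by omega) ((hNmem _ _).1 hq).2
    · exact hyno q (by omega) (by omega) ((hNmem _ _).1 hq).2
  have hsub : N x ∪ B₁ ∪ B₂ ∪ Finset.Ico (i + 3) (i + m) ⊆ Finset.range (c - g + 3) := by
    intro p hp
    simp only [Finset.mem_union, hB₁, hB₂, Finset.mem_map, addRightEmbedding_apply, hNmem,
      Finset.mem_Ico] at hp
    rw [Finset.mem_range]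
    rcases hp with ((hp | ⟨q, hq, rfl⟩) | ⟨q, hq, rfl⟩) | hp
    · have := hxF p hp.1 hp.2; omega
    · have := hyF q hq.1 hq.2; omega
    · have := hyF q hq.1 hq.2; omega
    · omega
  have hcard := Finset.card_le_card hsub
  rw [Finset.card_union_of_disjoint hd₃, Finset.card_union_of_disjoint hd₂,
    Finset.card_union_of_disjoint hd₁, hB₁, hB₂, Finset.card_map, Finset.card_map, Nat.card_Ico,
    Finset.card_range] at hcard
  omega

/-- Two off-cycle vertices, all of whose neighbours lie on the cycle and which have neighbours that
are consecutive on the cycle, cannot both have large degree. -/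
theorem add_two_mul_le (h : IsLongestCycleMap G f c) (hx : x ∉ Set.range f) (hy : y ∉ Set.range f)
    (hxy : x ≠ y) (hys : G.Adj y (f s)) (hxs : G.Adj x (f (s + 1))) :
    (G.neighborSet x ∩ Set.range f).ncard + 2 * (G.neighborSet y ∩ Set.range f).ncard
      ≤ c + 2 := by
  classical
  have hc := h.three_le
  set F : ℕ → V := fun i => f (s + 1 + i) with hF
  have hFc : IsLongestCycleMap G F c := h.shift (s + 1)
  have hrange : Set.range F = Set.range f := h.range_shift (s + 1)
  have hx0 : G.Adj x (F 0) := hxs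
  have hyL : G.Adj y (F (c - 1)) := by
    have : F (c - 1) = f s := by
      rw [← h.periodic s]
      exact congrArg f (by omega)
    rwa [this]
  have hcross : ∀ i e, e ≤ 1 → i + 1 + e < c → G.Adj y (F i) → ¬ G.Adj x (F (i + 1 + e)) := by
    intro i e he hi hyi hxi
    have hoff : ∀ z ∉ Set.range f, ∀ p m, z ∉ (List.range' p m).map F := by
      rintro z hz p m hz'
      obtain ⟨k, -, rfl⟩ := List.mem_map.1 hz'
      exact hz (hrange ▸ ⟨k, rfl⟩)
    have h₁ := ((hFc.isListPath_segment (i := i + 1 + e) (j := c - 1) (by omega)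
      (by omega)).cons hxi (hoff x hx _ _)).append
      ((hFc.isListPath_segment (i := 0) (j := i) (by omega) (by omega)).reverse.cons hyi
        (fun h' => hoff y hy _ _ (List.mem_reverse.1 h'))) hyL.symm (by
      intro v hv hv'
      simp only [List.mem_cons, List.mem_map, List.mem_reverse, List.mem_range'_1] at hv hv'
      rcases hv with rfl | ⟨p, hp, rfl⟩ <;> rcases hv' with hv' | ⟨q, hq, hv'⟩
      · exact hxy hv'
      · exact hx (hrange ▸ ⟨q, hv'⟩)
      · exact hy (hrange ▸ ⟨p, hv'⟩)
      · have := hFc.eq_of_apply_eq (by omega) (by omega) hv'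
        omega)
    have h₂ := h.length_le _ _ _ h₁ hx0.symm
    simp only [List.length_append, List.length_cons, List.length_reverse, List.length_map,
      List.length_range'] at h₂
    omega
  let N : V → Finset ℕ := fun z => (Finset.range c).filter fun i => G.Adj z (F i)
  have hNmem : ∀ z i, i ∈ N z ↔ i < c ∧ G.Adj z (F i) := by simp [N]
  have hNcard : ∀ z, (G.neighborSet z ∩ Set.range f).ncard ≤ (N z).card := by
    intro z
    rw [← Set.ncard_coe_finset]
    refine (Set.ncard_le_ncard (t := F '' (N z : Set ℕ)) ?_
      (Set.toFinite _)).trans (Set.ncard_image_le (Set.toFinite _))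
    rintro _ ⟨hv, k, rfl⟩
    obtain ⟨j, hj, e⟩ := h.exists_lt_shift (s + 1) k
    refine ⟨j, ?_, e⟩
    rw [Finset.mem_coe, hNmem]
    exact ⟨hj, show G.Adj z (f _) by rwa [e]⟩
  have hA := hNcard x
  have hB := hNcard y
  set B₁ := (N y).map (addRightEmbedding 1) with hB₁
  set B₂ := (N y).map (addRightEmbedding 2) with hB₂
  have hd₁ : Disjoint (N x) B₁ := by
    rw [Finset.disjoint_left]
    intro p hp hp'
    obtain ⟨q, hq, rfl⟩ := Finset.mem_map.1 hp'
    rw [hNmem] at hp hq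
    exact hcross q 0 (by omega) hp.1 hq.2 hp.2
  have hd₂ : Disjoint (N x ∪ B₁) B₂ := by
    rw [Finset.disjoint_left]
    intro p hp hp'
    obtain ⟨q, hq, rfl⟩ := Finset.mem_map.1 hp'
    rcases Finset.mem_union.1 hp with hp | hp
    · rw [hNmem] at hp hq
      exact hcross q 1 (by omega) hp.1 hq.2 hp.2
    · obtain ⟨q', hq', e⟩ := Finset.mem_map.1 hp
      simp only [addRightEmbedding_apply] at e
      obtain rfl : q' = q + 1 := by omega
      exact hFc.not_adj_succ (hrange ▸ hy) ((hNmem _ _).1 hq).2 ((hNmem _ _).1 hq').2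
  have hsub : N x ∪ B₁ ∪ B₂ ⊆ Finset.range (c + 2) := by
    intro p hp
    simp only [Finset.mem_union, hB₁, hB₂, Finset.mem_map, addRightEmbedding_apply, hNmem] at hp
    rw [Finset.mem_range]
    rcases hp with (hp | ⟨q, hq, rfl⟩) | ⟨q, hq, rfl⟩ <;> omega
  have hcard := Finset.card_le_card hsub
  rw [Finset.card_union_of_disjoint hd₂, Finset.card_union_of_disjoint hd₁, hB₁, hB₂,
    Finset.card_map, Finset.card_map, Finset.card_range] at hcard
  omega

end IsLongestCycleMap

/-- `H` is a connected component of `G` minus `C`, and `φ` maps `C` into itself while fixing all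
other vertices. -/
structure IsComponentContraction {V : Type*} (G : SimpleGraph V) (C H : Set V) (φ : V → V) :
    Prop where
  map_mem : ∀ z ∈ C, φ z ∈ C
  map_eq : ∀ z ∉ C, φ z = z
  notMem : ∀ z ∈ H, z ∉ C
  mem_or_mem : ∀ a ∈ H, ∀ b, G.Adj a b → b ∈ H ∨ b ∈ C
  reachIn : ∀ a ∈ H, ∀ b ∈ H, ReachIn G H a b

/-- The graph of the edges of `G` meeting `H`, with end vertices identified by `φ`. -/
def contractedGraph {V : Type*} (G : SimpleGraph V) (H : Set V) (φ : V → V) : SimpleGraph V :=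
  SimpleGraph.fromRel fun a b => a ∈ H ∧ ∃ b', G.Adj a b' ∧ φ b' = b

namespace IsComponentContraction

variable {V : Type*} {G : SimpleGraph V} {C H : Set V} {φ : V → V} {a b v w x y z : V}
  {l : List V}

theorem mem_of_map_mem (h : IsComponentContraction G C H φ) (hz : φ z ∈ C) : z ∈ C := by
  by_contra hz'
  exact hz' (h.map_eq z hz' ▸ hz)

theorem eq_of_map_mem (h : IsComponentContraction G C H φ) (hz : φ z ∈ H) : φ z = z := by
  by_cases hz' : z ∈ C
  · exact absurd (h.map_mem z hz') (h.notMem _ hz)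
  · exact h.map_eq z hz'

theorem adj_iff (h : IsComponentContraction G C H φ) (ha : a ∈ H) :
    (contractedGraph G H φ).Adj a b ↔ ∃ b', G.Adj a b' ∧ φ b' = b := by
  rw [contractedGraph, SimpleGraph.fromRel_adj]
  constructor
  · rintro ⟨-, ⟨-, hb⟩ | ⟨hb, a', hab, rfl⟩⟩
    · exact hb
    · rw [h.eq_of_map_mem ha]
      exact ⟨b, hab.symm, h.map_eq b (h.notMem b hb)⟩
  · rintro ⟨b', hab, rfl⟩
    refine ⟨?_, Or.inl ⟨ha, b', hab, rfl⟩⟩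
    rintro rfl
    rw [h.eq_of_map_mem ha] at hab
    exact G.loopless.irrefl _ hab

theorem adj_map (h : IsComponentContraction G C H φ) (ha : a ∈ H) (hab : G.Adj a b) :
    (contractedGraph G H φ).Adj a (φ b) :=
  (h.adj_iff ha).2 ⟨b, hab, rfl⟩

theorem adj_iff_of_mem (h : IsComponentContraction G C H φ) (ha : a ∈ H) (hb : b ∈ H) :
    (contractedGraph G H φ).Adj a b ↔ G.Adj a b := by
  rw [h.adj_iff ha]
  constructor
  · rintro ⟨b', hab, rfl⟩
    rwa [h.eq_of_map_mem hb]
  · exact fun hab => ⟨b, hab, h.map_eq b (h.notMem b hb)⟩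

theorem isListPath (h : IsComponentContraction G C H φ)
    (hl : IsListPath (contractedGraph G H φ) l x y) (hlH : ∀ z ∈ l, z ∈ H) :
    IsListPath G l x y where
  nodup := hl.nodup
  chain := by
    have := hl.chain
    rw [List.isChain_iff_getElem] at this ⊢
    exact fun i hi => (h.adj_iff_of_mem (hlH _ (List.getElem_mem _))
      (hlH _ (List.getElem_mem _))).1 (this i hi)
  head := hl.head
  last := hl.last

theorem reachIn_contracted (h : IsComponentContraction G C H φ) (ha : a ∈ H) (hb : b ∈ H) :
    ReachIn (contractedGraph G H φ) H a b :=
  (h.reachIn a ha b hb).mem_of_closed {b | ReachIn (contractedGraph G H φ) H a b} (.refl _)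
    fun _ hu huH _ hw huw => ReachIn.trans hu (.of_adj ((h.adj_iff_of_mem huH hw).2 huw) huH hw)

theorem exists_reachIn (h : IsComponentContraction G C H φ) (hv : v ∈ H) (hw : w ∈ H)
    (hwv : w ≠ v) (hr : ∃ t ∈ C, ReachIn G {v}ᶜ w t) :
    ∃ z ∈ φ '' C, ReachIn (contractedGraph G H φ) ((H ∪ φ '' C) \ {v}) w z := by
  obtain ⟨t, ht, hr⟩ := hr
  by_contra! hno
  refine h.notMem t (hr.mem_of_closed
    {a | a ∈ H ∧ ReachIn (contractedGraph G H φ) ((H ∪ φ '' C) \ {v}) w a} ⟨hw, .refl _⟩ ?_).1 ht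
  rintro u ⟨hu, hwu⟩ huv b hbv hub
  rcases h.mem_or_mem u hu b hub with hb | hb
  · exact ⟨hb, hwu.trans (.of_adj ((h.adj_iff_of_mem hu hb).2 hub) ⟨Or.inl hu, huv⟩
      ⟨Or.inl hb, hbv⟩)⟩
  · refine absurd (hwu.trans (.of_adj (h.adj_map hu hub) ⟨Or.inl hu, huv⟩
      ⟨Or.inr ⟨b, hb, rfl⟩, ?_⟩)) (hno _ ⟨b, hb, rfl⟩)
    rintro rfl
    exact h.notMem _ hv (h.map_mem b hb)

theorem le_ncard_add [Finite V] (h : IsComponentContraction G C H φ) (hw : w ∈ H) {δ μ : ℕ}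
    (hδ : δ ≤ (G.neighborSet w).ncard) (hμ : 1 ≤ μ)
    (hwC : (G.neighborSet w ∩ C).ncard ≤ μ) :
    δ + 1 ≤ ((H ∪ φ '' C) ∩ (contractedGraph G H φ).neighborSet w).ncard + μ := by
  have hsum := Set.ncard_inter_add_ncard_sdiff_eq_ncard (G.neighborSet w) C (Set.toFinite _)
  have hsub : G.neighborSet w \ C ⊆
      (H ∪ φ '' C) ∩ (contractedGraph G H φ).neighborSet w := by
    rintro b ⟨hwb, hb⟩
    have hbH := (h.mem_or_mem w hw b hwb).resolve_right hb
    exact ⟨Or.inl hbH, (h.adj_iff_of_mem hw hbH).2 hwb⟩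
  rcases (G.neighborSet w ∩ C).eq_empty_or_nonempty with he | ⟨z, hwz, hz⟩
  · have := Set.ncard_le_ncard hsub (Set.toFinite _)
    rw [he, Set.ncard_empty] at hsum
    omega
  · have hsub' : insert (φ z) (G.neighborSet w \ C) ⊆
        (H ∪ φ '' C) ∩ (contractedGraph G H φ).neighborSet w :=
      Set.insert_subset ⟨Or.inr ⟨z, hz, rfl⟩, h.adj_map hw hwz⟩ hsub
    have h1 := Set.ncard_le_ncard hsub' (Set.toFinite _)
    rw [Set.ncard_insert_of_notMem (fun h' => h'.2 (h.map_mem z hz)) (Set.toFinite _)] at h1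
    omega

end IsComponentContraction

namespace IsLongestCycleMap

variable {V : Type*} {G : SimpleGraph V} {f : ℕ → V} {c : ℕ}

/-- **Dirac's theorem** on the circumference of a 2-connected graph. -/
theorem two_mul_le [Finite V] (h : IsLongestCycleMap G f c)
    (h2 : ∀ v a b : V, a ≠ v → b ≠ v → ReachIn G {v}ᶜ a b) {δ : ℕ}
    (hδ : ∀ v, δ ≤ (G.neighborSet v).ncard) {u : V} (hu : u ∉ Set.range f) : 2 * δ ≤ c := by
  classical
  set C := Set.range f with hC
  set H : Set V := {w | ReachIn G Cᶜ u w} with hH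
  have huH : u ∈ H := ReachIn.refl u
  have hHC : ∀ z ∈ H, z ∉ C := fun z hz => ReachIn.mem hz hu
  have hcl : ∀ a ∈ H, ∀ b, G.Adj a b → b ∈ H ∨ b ∈ C := by
    intro a ha b hab
    by_cases hb : b ∈ C
    · exact Or.inr hb
    · exact Or.inl (ReachIn.trans ha (.of_adj hab (hHC a ha) hb))
  have hreach : ∀ a ∈ H, ReachIn G H u a := by
    intro a ha
    refine (ReachIn.mem_of_closed ha {a | a ∈ H ∧ ReachIn G H u a} ⟨huH, .refl _⟩ ?_).2
    rintro a ⟨ha, hua⟩ - b hb hab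
    have hbH := (hcl a ha b hab).resolve_right hb
    exact ⟨hbH, hua.trans (.of_adj hab ha hbH)⟩
  have hcontr : ∀ φ : V → V, (∀ z ∈ C, φ z ∈ C) → (∀ z ∉ C, φ z = z) →
      IsComponentContraction G C H φ := fun φ h₁ h₂ =>
    ⟨h₁, h₂, hHC, hcl, fun a ha b hb => (hreach a ha).symm.trans (hreach b hb)⟩
  have hexit : ∀ w ∈ H, ∀ v, w ≠ v → ∀ t ∈ C, t ≠ v → ∃ a ∈ H, ∃ b ∈ C, b ≠ v ∧ G.Adj a b := by
    intro w hw v hwv t ht htv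
    by_contra! hno
    refine hHC t ((h2 v w t hwv htv).mem_of_closed H hw fun a ha _ b hb hab => ?_) ht
    exact (hcl a ha b hab).resolve_right fun hb' => hno a ha b hb' hb hab
  have hf : ∀ i, f i ∈ C := fun i => ⟨i, rfl⟩
  obtain ⟨h₁, hh₁, y₀, hy₀, hy₀f, hadj₁⟩ :=
    hexit u huH (f 1) (fun e => hu (e ▸ hf 1)) (f 0) (hf 0) (h.adj 0).ne
  obtain ⟨x', hx', hmax⟩ := Set.exists_max_image H (fun w => (G.neighborSet w ∩ C).ncard)
    (Set.toFinite _) ⟨u, huH⟩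
  set μ := (G.neighborSet x' ∩ C).ncard with hμ
  have hμ1 : 1 ≤ μ := by
    refine le_trans ?_ (hmax h₁ hh₁)
    exact Set.Nonempty.ncard_pos (Set.toFinite _) ⟨y₀, hadj₁, hy₀⟩
  rcases Nat.lt_or_ge 1 μ with hμ2 | hμ2
  · let φ : V → V := fun z => if z ∈ C then f 0 else z
    have hφC : ∀ z ∈ C, φ z = f 0 := fun z hz => if_pos hz
    have hφ : IsComponentContraction G C H φ :=
      hcontr φ (fun z hz => hφC z hz ▸ hf 0) fun z hz => if_neg hz
    have himg : φ '' C = {f 0} := by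
      ext z
      constructor
      · rintro ⟨z, hz, rfl⟩
        exact hφC z hz
      · rintro rfl
        exact ⟨f 0, hf 0, hφC _ (hf 0)⟩
    have hne : ∀ w ∈ H, w ≠ f 0 := fun w hw e => hHC w hw (e ▸ hf 0)
    have hcase : ∀ w ∈ H ∪ φ '' C, w ≠ f 0 → w ∈ H := by
      rintro w (hw | hw) hwf
      · exact hw
      · rw [himg] at hw
        exact absurd hw hwf
    have hf0 : f 0 ∈ H ∪ φ '' C := Or.inr (himg ▸ rfl)
    obtain ⟨l, hl, hlS, hlen⟩ := exists_isListPath_of_le_degree (contractedGraph G H φ) (δ + 1 - μ)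
      (H ∪ φ '' C) x' (f 0) (Or.inl hx') hf0 (hne x' hx') (by
        obtain ⟨z, hxz, hz⟩ := Set.nonempty_of_ncard_ne_zero
          (s := G.neighborSet x' ∩ C) (by omega)
        exact .of_adj (hφC z hz ▸ hφ.adj_map hx' hxz) (Or.inl hx') hf0) (by
        intro hd
        by_contra! hno
        have hsub : G.neighborSet x' ⊆ G.neighborSet x' ∩ C := by
          intro b hb
          refine ⟨hb, (hcl x' hx' b hb).resolve_left fun hbH => hne b hbH (hno b (Or.inl hbH) ?_)⟩
          rintro rfl
          exact G.loopless.irrefl _ hb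
        have := Set.ncard_le_ncard hsub (Set.toFinite _)
        have := hδ x'
        omega) (by
        intro v hv w hw hwv
        by_cases hwf : w = f 0
        · right; rw [hwf]; exact .refl _
        have hwH := hcase w hw hwf
        by_cases hvf : v = f 0
        · left
          refine (hφ.reachIn_contracted hwH hx').mono fun a ha => ⟨Or.inl ha, ?_⟩
          rw [hvf]
          exact hne a ha
        · right
          have hvH := hcase v hv hvf
          obtain ⟨z, hz, hr⟩ := hφ.exists_reachIn hvH hwH hwv
            ⟨f 0, hf 0, h2 v w (f 0) hwv (Ne.symm hvf)⟩
          rw [himg] at hz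
          obtain rfl : z = f 0 := hz
          exact hr) (by
        intro w hw _ hwf
        have hwH := hcase w hw hwf
        have := hφ.le_ncard_add hwH (hδ w) hμ1 (hmax w hwH)
        omega)
    obtain ⟨e, l₀, rfl, hadj, hl₀⟩ := hl.exists_eq_concat (hne x' hx')
    have hl₀H : ∀ a ∈ l₀, a ∈ H := fun a ha => hcase a (hlS a (by simp [ha])) (by
      rintro rfl
      exact (List.nodup_append.1 hl.nodup).2.2 _ ha _ (by simp) rfl)
    obtain ⟨b, heb, hb⟩ := (hφ.adj_iff (hl₀H e hl₀.last_mem)).1 hadj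
    obtain ⟨s, rfl⟩ := hφ.mem_of_map_mem (hb ▸ hf 0)
    have hcard := Set.le_ncard_sdiff {f s} (G.neighborSet x' ∩ C) (Set.toFinite _)
    rw [Set.ncard_singleton] at hcard
    have hc := h.two_mul_length_add_le (hφ.isListPath hl₀ hl₀H) (fun z hz => hHC z (hl₀H z hz)) heb
      (show ((G.neighborSet x' ∩ C) \ {f s}).Nonempty from
        Set.nonempty_of_ncard_ne_zero (by omega))
    rw [← hC] at hc
    have := hl₀.length_pos
    rw [List.length_append, List.length_singleton] at hlen
    omega
  · obtain ⟨x₀, hx₀, hxy⟩ : ∃ x₀ ∈ C, x₀ ≠ y₀ := ⟨f 1, hf 1, hy₀f.symm⟩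
    let φ : V → V := fun z => if z ∈ C then if z = y₀ then y₀ else x₀ else z
    have hφy : φ y₀ = y₀ := by simp [φ, hy₀]
    have hφx : ∀ z ∈ C, z ≠ y₀ → φ z = x₀ := fun z hz hzy => by simp [φ, hz, hzy]
    have hφ : IsComponentContraction G C H φ := hcontr φ (fun z hz => by
      by_cases hzy : z = y₀
      · rw [hzy, hφy]; exact hy₀
      · rw [hφx z hz hzy]; exact hx₀) fun z hz => if_neg hz
    have hx₀S : x₀ ∈ H ∪ φ '' C := Or.inr ⟨x₀, hx₀, hφx x₀ hx₀ hxy⟩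
    have hy₀S : y₀ ∈ H ∪ φ '' C := Or.inr ⟨y₀, hy₀, hφy⟩
    have himg : ∀ z ∈ φ '' C, z = x₀ ∨ z = y₀ := by
      rintro _ ⟨z, hz, rfl⟩
      by_cases hzy : z = y₀
      · right; rw [hzy, hφy]
      · left; rw [hφx z hz hzy]
    have hcase : ∀ w ∈ H ∪ φ '' C, w ≠ x₀ → w ≠ y₀ → w ∈ H := by
      rintro w (hw | hw) hwx hwy
      · exact hw
      · rcases himg w hw with e | e
        exacts [absurd e hwx, absurd e hwy]
    have hnex : ∀ w ∈ H, w ≠ x₀ := fun w hw e => hHC w hw (e ▸ hx₀)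
    have hney : ∀ w ∈ H, w ≠ y₀ := fun w hw e => hHC w hw (e ▸ hy₀)
    obtain ⟨h₂, hh₂, b₂, hb₂, hb₂y, hadj₂⟩ :=
      hexit u huH y₀ (hney u huH) x₀ hx₀ hxy
    have hadjx : (contractedGraph G H φ).Adj h₂ x₀ := hφx b₂ hb₂ hb₂y ▸ hφ.adj_map hh₂ hadj₂
    have hadjy : (contractedGraph G H φ).Adj h₁ y₀ := by
      have := hφ.adj_map hh₁ hadj₁
      rwa [hφy] at this
    have hreachx : ∀ w ∈ H, ReachIn (contractedGraph G H φ) ((H ∪ φ '' C) \ {y₀}) w x₀ :=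
      fun w hw => ((hφ.reachIn_contracted hw hh₂).mono (T := (H ∪ φ '' C) \ {y₀})
        fun a ha => ⟨Or.inl ha, hney a ha⟩).trans
        (.of_adj hadjx ⟨Or.inl hh₂, hney _ hh₂⟩ ⟨hx₀S, hxy⟩)
    have hreachy : ∀ w ∈ H, ReachIn (contractedGraph G H φ) ((H ∪ φ '' C) \ {x₀}) w y₀ :=
      fun w hw => ((hφ.reachIn_contracted hw hh₁).mono (T := (H ∪ φ '' C) \ {x₀})
        fun a ha => ⟨Or.inl ha, hnex a ha⟩).trans
        (.of_adj hadjy ⟨Or.inl hh₁, hnex _ hh₁⟩ ⟨hy₀S, hxy.symm⟩)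
    obtain ⟨l, hl, hlS, hlen⟩ := exists_isListPath_of_le_degree (contractedGraph G H φ) δ
      (H ∪ φ '' C) x₀ y₀ hx₀S hy₀S hxy
      (((hreachx u huH).mono Set.sdiff_subset).symm.trans ((hreachy u huH).mono Set.sdiff_subset))
      (fun _ => ⟨u, Or.inl huH, hnex u huH, hney u huH⟩) (by
        intro v hv w hw hwv
        by_cases hwx : w = x₀
        · left; rw [hwx]; exact .refl _
        by_cases hwy : w = y₀
        · right; rw [hwy]; exact .refl _
        have hwH := hcase w hw hwx hwy
        by_cases hvx : v = x₀
        · right; rw [hvx]; exact hreachy w hwH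
        by_cases hvy : v = y₀
        · left; rw [hvy]; exact hreachx w hwH
        obtain ⟨z, hz, hr⟩ := hφ.exists_reachIn (hcase v hv hvx hvy) hwH hwv
          ⟨x₀, hx₀, h2 v w x₀ hwv (Ne.symm hvx)⟩
        rcases himg z hz with rfl | rfl
        exacts [Or.inl hr, Or.inr hr]) (by
        intro w hw hwx hwy
        have hwH := hcase w hw hwx hwy
        have := hφ.le_ncard_add hwH (hδ w) le_rfl ((hmax w hwH).trans hμ2)
        omega)
    obtain ⟨z, l', rfl, hadjz, hl'⟩ := hl.exists_eq_cons hxy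
    have hzy : z ≠ y₀ := by
      rintro rfl
      rw [contractedGraph, SimpleGraph.fromRel_adj] at hadjz
      rcases hadjz.2 with h' | h'
      exacts [hnex _ h'.1 rfl, hney _ h'.1 rfl]
    obtain ⟨e, l₀, rfl, hadj, hl₀⟩ := hl'.exists_eq_concat hzy
    have hl₀H : ∀ a ∈ l₀, a ∈ H := fun a ha => hcase a (hlS a (by simp [ha]))
      (by
        rintro rfl
        exact (List.nodup_cons.1 hl.nodup).1 (by simp [ha]))
      (by
        rintro rfl
        exact (List.nodup_append.1 hl'.nodup).2.2 _ ha _ (by simp) rfl)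
    have hmap : ∀ b, φ b ∈ C → φ b ≠ x₀ → b = y₀ := fun b hb hbx => by
      by_contra hby
      exact hbx (hφx b (hφ.mem_of_map_mem hb) hby)
    obtain ⟨b, heb, hb⟩ := (hφ.adj_iff (hl₀H e hl₀.last_mem)).1 hadj
    obtain rfl := hmap b (hb ▸ hy₀) (hb ▸ hxy.symm)
    obtain ⟨b', hzb', hb'⟩ := (hφ.adj_iff (hl₀H z hl₀.head_mem)).1 hadjz.symm
    have hb'C : b' ∈ C := hφ.mem_of_map_mem (hb' ▸ hx₀)
    have hb'b : b' ≠ b := by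
      rintro rfl
      exact hxy (hb'.symm.trans hb)
    obtain ⟨s, rfl⟩ := hy₀
    have hne : ((G.neighborSet z ∩ C) \ {f s}).Nonempty := ⟨b', ⟨hzb', hb'C⟩, hb'b⟩
    have hc := h.two_mul_length_add_le (hφ.isListPath hl₀ hl₀H) (fun z hz => hHC z (hl₀H z hz)) heb
      hne
    rw [← hC] at hc
    have := hne.ncard_pos (Set.toFinite _)
    simp only [List.length_append, List.length_cons, List.length_nil] at hlen
    omega

/-- **Nash-Williams' theorem**: in a 2-connected graph with minimum degree at least `(n + 2) / 3`,
the vertices off a longest cycle are independent. -/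
theorem not_adj_of_notMem [Finite V] (h : IsLongestCycleMap G f c)
    (h2 : ∀ v a b : V, a ≠ v → b ≠ v → ReachIn G {v}ᶜ a b) {δ : ℕ}
    (hδ : ∀ v, δ ≤ (G.neighborSet v).ncard) (hn : Nat.card V + 2 ≤ 3 * δ) {u u' : V}
    (hu : u ∉ Set.range f) (hu' : u' ∉ Set.range f) : ¬ G.Adj u u' := by
  classical
  intro hadj
  have hcard : ∀ l x y, IsListPath G l x y → (∀ z ∈ l, z ∉ Set.range f) →
      c + l.length ≤ Nat.card V := by
    intro l x y hl hoff
    have hd : Disjoint (Set.range f) (l.toFinset : Set V) := by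
      rw [Set.disjoint_right]
      intro z hz
      exact hoff z (by simpa using hz)
    have := Set.ncard_le_card (Set.range f ∪ (l.toFinset : Set V))
    rwa [Set.ncard_union_eq hd (Set.toFinite _) (Set.toFinite _), h.ncard_range,
      Set.ncard_coe_finset, List.toFinset_card_of_nodup hl.nodup] at this
  let P : ℕ → Prop := fun r => ∃ l x y, IsListPath G l x y ∧ (∀ z ∈ l, z ∉ Set.range f) ∧
    l.length = r
  have hP2 : P 2 := ⟨[u, u'], u, u', (IsListPath.singleton u').cons hadj (by simpa using hadj.ne),
    List.forall_mem_cons.2 ⟨hu, List.forall_mem_singleton.2 hu'⟩, rfl⟩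
  have hPle : ∀ r, P r → r ≤ Nat.card V := by
    rintro r ⟨l, x, y, hl, hoff, rfl⟩
    have := hcard l x y hl hoff
    omega
  obtain ⟨l, x, y, hl, hoff, hr⟩ := Nat.findGreatest_spec (hPle 2 hP2) hP2
  have hr2 := Nat.le_findGreatest (hPle 2 hP2) hP2
  have hmax : ∀ r, P r → r ≤ l.length := fun r h' => hr ▸ Nat.le_findGreatest (hPle r h') h'
  rw [← hr] at hr2
  have hend : ∀ l' x y, IsListPath G l' x y → (∀ z ∈ l', z ∉ Set.range f) →
      l'.length = l.length → δ + 1 ≤ (G.neighborSet x ∩ Set.range f).ncard + l.length := by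
    intro l' x y hl' hoff' hlen
    have hsub : G.neighborSet x ⊆
        (G.neighborSet x ∩ Set.range f) ∪ ((l'.toFinset.erase x : Finset V) : Set V) := by
      intro z hz
      by_cases hzC : z ∈ Set.range f
      · exact Or.inl ⟨hz, hzC⟩
      right
      have hz : G.Adj x z := hz
      have hzx : z ≠ x := hz.ne'
      by_contra hzl
      have hzl : z ∉ l' := by simpa [hzx] using hzl
      have := hmax (z :: l').length ⟨z :: l', z, y, hl'.cons hz.symm hzl,
        List.forall_mem_cons.2 ⟨hzC, hoff'⟩, rfl⟩
      rw [List.length_cons] at this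
      omega
    have h₁ := (hδ x).trans ((Set.ncard_le_ncard hsub (Set.toFinite _)).trans
      (Set.ncard_union_le _ _))
    rw [Set.ncard_coe_finset, Finset.card_erase_of_mem (by simpa using hl'.head_mem),
      List.toFinset_card_of_nodup hl'.nodup] at h₁
    have := hl'.length_pos
    omega
  have hx := hend l x y hl hoff rfl
  have hy := hend l.reverse y x hl.reverse (by simpa using hoff) (by simp)
  have hn' := hcard l x y hl hoff
  rcases Nat.lt_or_ge l.length δ with hlt | hge
  · have := h.three_mul_add_le hl hoff hr2 (a := δ + 1 - l.length) (by omega) (by omega) (by omega)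
    omega
  · have := h.two_mul_le h2 hδ hu
    omega

/-- In a 2-connected graph with minimum degree at least `(n + 2) / 3`, neighbours of vertices off a
longest cycle are not consecutive on it. -/
theorem not_adj_succ_of_notMem [Finite V] (h : IsLongestCycleMap G f c)
    (h2 : ∀ v a b : V, a ≠ v → b ≠ v → ReachIn G {v}ᶜ a b) {δ : ℕ}
    (hδ : ∀ v, δ ≤ (G.neighborSet v).ncard) (hn : Nat.card V + 2 ≤ 3 * δ) {x y : V} {s : ℕ}
    (hx : x ∉ Set.range f) (hy : y ∉ Set.range f) (hys : G.Adj y (f s)) :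
    ¬ G.Adj x (f (s + 1)) := by
  intro hxs
  by_cases hxy : x = y
  · subst hxy
    exact h.not_adj_succ hx hys hxs
  have hsub : ∀ z ∉ Set.range f, δ ≤ (G.neighborSet z ∩ Set.range f).ncard := by
    intro z hz
    rw [Set.inter_eq_left.2]
    · exact hδ z
    · intro b hb
      by_contra hbC
      exact h.not_adj_of_notMem h2 hδ hn hz hbC hb
  have h₁ := h.add_two_mul_le hx hy hxy hys hxs
  have h₂ := hsub x hx
  have h₃ := hsub y hy
  have h₄ := Set.ncard_le_card (Set.range f ∪ {x, y})
  have hd : Disjoint (Set.range f) {x, y} := by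
    rw [Set.disjoint_right]
    rintro z (rfl | rfl)
    exacts [hx, hy]
  rw [Set.ncard_union_eq hd (Set.toFinite _) (Set.toFinite _), h.ncard_range,
    Set.ncard_pair hxy] at h₄
  omega

end IsLongestCycleMap

theorem IsListPath.exists_walk {V : Type*} {G : SimpleGraph V} {l : List V} {x y : V}
    (h : IsListPath G l x y) : ∃ p : G.Walk x y, p.support = l := by
  obtain ⟨-, hc, hh, hl⟩ := h
  have hne : l ≠ [] := by rintro rfl; simp at hh
  obtain rfl : l.head hne = x := by rw [List.head?_eq_some_head hne] at hh; simpa using hh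
  obtain rfl : l.getLast hne = y := by rw [List.getLast?_eq_some_getLast hne] at hl; simpa using hl
  exact ⟨Walk.ofSupport l hne hc, Walk.support_ofSupport hne hc⟩

theorem isLongestCycleMap_getVert {V : Type*} {G : SimpleGraph V} {v : V} {p : G.Walk v v}
    (hp : p.IsCycle) (hmax : ∀ (w : V) (q : G.Walk w w), q.IsCycle → q.length ≤ p.length) :
    IsLongestCycleMap G (fun i => p.getVert (i % p.length)) p.length := by
  have h3 := hp.three_le_length
  refine ⟨h3, fun i => by simp, fun i => ?_, fun i j e => ?_, fun l x y hl e h3l => ?_⟩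
  · have hi := Nat.mod_lt i (show 0 < p.length by omega)
    have hadj := p.adj_getVert_succ hi
    rcases Nat.lt_or_ge (i % p.length + 1) p.length with hlt | hge
    · rwa [show (i + 1) % p.length = i % p.length + 1 by
        rw [Nat.add_mod, Nat.mod_eq_of_lt (show 1 < p.length by omega), Nat.mod_eq_of_lt hlt]]
    · have heq : i % p.length + 1 = p.length := by omega
      rw [heq, p.getVert_length] at hadj
      rwa [show (i + 1) % p.length = 0 by
        rw [Nat.add_mod, Nat.mod_eq_of_lt (show 1 < p.length by omega), heq, Nat.mod_self],
        p.getVert_zero]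
  · have hi := Nat.mod_lt i (show 0 < p.length by omega)
    have hj := Nat.mod_lt j (show 0 < p.length by omega)
    refine hp.getVert_injOn' ?_ ?_ e <;> simp only [Set.mem_ofPred_eq] <;> omega
  · obtain ⟨q, rfl⟩ := hl.exists_walk
    have hq : q.IsPath := Walk.IsPath.mk' hl.nodup
    rw [Walk.length_support] at h3l ⊢
    have := hmax y (.cons e q) ((Walk.cons_isCycle_iff q e).2 ⟨hq, fun hmem => by
      have := hq.length_eq_one_of_mem_edges (Sym2.eq_swap ▸ hmem)
      omega⟩)
    simpa using this

theorem TwoConnected.reachIn {V : Type*} [Fintype V] {G : SimpleGraph V} (h : TwoConnected G)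
    {v a b : V} (ha : a ≠ v) (hb : b ≠ v) : ReachIn G {v}ᶜ a b := by
  obtain ⟨w⟩ := (h.2 v).preconnected ⟨a, ha⟩ ⟨b, hb⟩
  suffices ∀ (x y : {w | w ≠ v}), (G.induce {w | w ≠ v}).Walk x y → ReachIn G {v}ᶜ x y from
    this _ _ w
  intro x y w
  induction w with
  | nil => exact .refl _
  | @cons x z _ e _ ih => exact (ReachIn.of_adj (G := G) (a := x) (b := z) e x.2 z.2).trans ih

theorem add_two_le_three_mul_of_degBound_le {k n δ : ℕ} (hk : 3 ≤ k) (hn : 2 * k ≤ n)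
    (hdvd : k ∣ n) (hexc : ¬ (n = 8 ∧ k = 4)) (hδ : degBound n k ≤ (δ : ℚ)) :
    n + 2 ≤ 3 * δ := by
  obtain ⟨m, rfl⟩ := hdvd
  have hm : 2 ≤ m := by
    by_contra hlt
    have : k * m ≤ k * 1 := Nat.mul_le_mul_left k (by omega)
    omega
  have hceil : ∀ a : ℕ, ⌈(a : ℚ) / 2⌉ = ((a + 1) / 2 : ℕ) := by
    intro a
    rw [Int.ceil_eq_iff]
    have h1 : 2 * ((a + 1) / 2) ≤ a + 1 := by omega
    have h2 : a ≤ 2 * ((a + 1) / 2) := by omega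
    have h1' : (2 : ℚ) * (((a + 1) / 2 : ℕ) : ℚ) ≤ a + 1 := by exact_mod_cast h1
    have h2' : (a : ℚ) ≤ 2 * (((a + 1) / 2 : ℕ) : ℚ) := by exact_mod_cast h2
    rw [Int.cast_natCast]
    constructor <;> linarith
  set N := k * m with hN
  set t := (k + 1 + 1) / 2 with ht
  have hkey : (N + 1) / 2 + (N + 2) / (2 * t) ≤ δ + m := by
    have hk0 : (k : ℚ) ≠ 0 := by positivity
    have hfloor := Rat.floor_natCast_div_natCast (N + 2) (2 * t)
    have hquot : (N : ℚ) / k = m := by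
      rw [hN, Nat.cast_mul, mul_div_cancel_left₀ _ hk0]
    have hceil' := hceil (k + 1)
    rw [← ht] at hceil'
    push_cast at hfloor hceil'
    rw [degBound, hceil N, hceil', hquot, Int.cast_natCast, Int.cast_natCast, hfloor,
      sub_le_iff_le_add] at hδ
    norm_cast at hδ
    exact_mod_cast hδ
  set F := (N + 2) / (2 * t) with hF
  have hFt : N + 2 < 2 * t * (F + 1) := by
    have := Nat.lt_mul_div_succ (N + 2) (show 0 < 2 * t by omega)
    simpa using this
  obtain rfl | rfl | hk5 : k = 3 ∨ k = 4 ∨ 5 ≤ k := by omega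
  · have ht2 : t = 2 := by omega
    rw [ht2] at hF
    omega
  · have ht3 : t = 3 := by omega
    rw [ht3] at hF
    omega
  · by_contra! hlt
    have h₁ : 6 * F + N ≤ 6 * m + 2 := by omega
    have h₂ : N + 3 ≤ (k + 2) * (F + 1) :=
      le_trans hFt (Nat.mul_le_mul_right _ (by omega))
    zify at h₁ h₂ hN hk5 hm
    have h₃ : (k + 2 : ℤ) * (6 * F + N) ≤ (k + 2) * (6 * m + 2) :=
      mul_le_mul_of_nonneg_left h₁ (by omega)
    rw [hN] at h₂ h₃
    have h₄ : (0 : ℤ) ≤ (k ^ 2 + 2 * k - 12) * (m - 2) :=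
      mul_nonneg (by nlinarith) (by omega)
    nlinarith

/-- Let `k ≥ 3`, let `n ≥ 2k` be divisible by `k` with not both `n = 8` and `k = 4`, and let
`G` be a balanced `k`-partite graph on `n` vertices.  If `G` is 2-connected and
`δ(G) ≥ ⌈n/2⌉ + ⌊(n+2)/(2⌈(k+1)/2⌉)⌋ − n/k`, then every longest cycle of `G` is strongly
dominating. -/
theorem balanced_kpartite_longest_cycle_strongly_dominating
    {V : Type*} [Fintype V] [DecidableEq V] (G : SimpleGraph V) [DecidableRel G.Adj]
    (k n : ℕ) (hk : 3 ≤ k) (hn : 2 * k ≤ n) (hcard : Fintype.card V = n) (hdvd : k ∣ n)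
    (hexc : ¬ (n = 8 ∧ k = 4))
    (hG : IsBalancedKPartite G k)
    (h2 : TwoConnected G)
    (hδ : degBound n k ≤ (G.minDegree : ℚ)) :
    ∀ (v : V) (p : G.Walk v v), p.IsCycle →
      (∀ (w : V) (q : G.Walk w w), q.IsCycle → q.length ≤ p.length) →
      IsStronglyDominating G p := by
  intro v p hp hmax
  have h := isLongestCycleMap_getVert hp hmax
  set f : ℕ → V := fun i => p.getVert (i % p.length) with hf
  have hdeg : ∀ v, G.minDegree ≤ (G.neighborSet v).ncard := fun v => by
    rw [Set.ncard_eq_toFinset_card']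
    exact G.minDegree_le_degree v
  have hbound : Nat.card V + 2 ≤ 3 * G.minDegree := by
    rw [Nat.card_eq_fintype_card, hcard]
    exact add_two_le_three_mul_of_degBound_le hk hn hdvd hexc hδ
  have hreach : ∀ v a b : V, a ≠ v → b ≠ v → ReachIn G {v}ᶜ a b := fun _ _ _ => h2.reachIn
  have hoff : ∀ a, a ∉ p.support → a ∉ Set.range f := by
    rintro _ ha ⟨i, rfl⟩
    exact ha (p.getVert_mem_support _)
  have hcons : ∀ i a b, (∃ u, u ∉ p.support ∧ G.Adj u a) → (∃ u, u ∉ p.support ∧ G.Adj u b) →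
      f i = a → f (i + 1) ≠ b := by
    rintro i _ _ ⟨y, hy, hya⟩ ⟨x, hx, hxb⟩ rfl rfl
    exact h.not_adj_succ_of_notMem hreach hdeg hbound (hoff x hx) (hoff y hy) hya hxb
  refine ⟨fun a b ha hb => h.not_adj_of_notMem hreach hdeg hbound (hoff a ha) (hoff b hb),
    fun a b ha hb hab => ?_⟩
  obtain ⟨i, hi, e⟩ := p.mk_mem_edges_iff_exists.1 hab
  have hfi : f i = p.getVert i := by simp only [hf, Nat.mod_eq_of_lt hi]
  have hfi' : f (i + 1) = p.getVert (i + 1) := by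
    obtain hlt | heq : i + 1 < p.length ∨ i + 1 = p.length := by omega
    · simp only [hf, Nat.mod_eq_of_lt hlt]
    · simp only [hf, heq, Nat.mod_self, p.getVert_zero, p.getVert_length]
  rw [← hfi, ← hfi', Sym2.eq_iff] at e
  obtain ⟨e₁, e₂⟩ | ⟨e₁, e₂⟩ := e
  exacts [hcons i a b ha hb e₁ e₂, hcons i b a hb ha e₁ e₂]
end

section
/- Let n ≥ 8 be divisible by 4, let k = n/2, and let G be a balanced k-partite graph on n vertices with δ(G) ≥ n/2 − 1. If G does not have a Hamiltonian cycle, then at least one of the following holds: the vertex connectivity of G is at most 1; or n = 8 and the independence number of G equals 3; or the independence number of G equals n/2. -/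
open SimpleGraph Finset

/-- The vertex connectivity of `G` is at most `1`: removing some set of at most one vertex
disconnects the graph. -/
def ConnectivityAtMostOne {V : Type*} (G : SimpleGraph V) : Prop :=
  ∃ S : Set V, S.ncard ≤ 1 ∧ ¬ (G.induce Sᶜ).Connected

/-- The independence number of `G` equals `m`: there is an independent set of size `m` and
every independent set has size at most `m`. -/
def HasIndepNum {V : Type*} [Fintype V] [DecidableEq V] (G : SimpleGraph V) (m : ℕ) : Prop :=
  (∃ s : Finset V, s.card = m ∧ ∀ u ∈ s, ∀ v ∈ s, u ≠ v → ¬ G.Adj u v) ∧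
  (∀ s : Finset V, (∀ u ∈ s, ∀ v ∈ s, u ≠ v → ¬ G.Adj u v) → s.card ≤ m)

/-- `S` is the vertex set of a path from `a` to `b` in the relation `R`. -/
def PathOn {α : Type*} [DecidableEq α] (R : α → α → Prop) (a b : α) (S : Finset α) : Prop :=
  ∃ l : List α, l.IsChain R ∧ l.Nodup ∧ l.head? = some a ∧ l.getLast? = some b ∧ l.toFinset = S

namespace PathOn

variable {α β : Type*} [DecidableEq α] [DecidableEq β] {R : α → α → Prop} {a b c d : α}
  {S T : Finset α}

theorem single (R : α → α → Prop) (a : α) : PathOn R a a {a} :=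
  ⟨[a], by simp⟩

theorem append (h : PathOn R a b S) (hbc : R b c) (h' : PathOn R c d T) (hST : Disjoint S T) :
    PathOn R a d (S ∪ T) := by
  obtain ⟨l, h1, h2, h3, h4, rfl⟩ := h
  obtain ⟨m, g1, g2, g3, g4, rfl⟩ := h'
  refine ⟨l ++ m, ?_, ?_, ?_, ?_, ?_⟩
  · rw [List.isChain_append]
    exact ⟨h1, g1, by simp [h4, g3, hbc]⟩
  · rw [List.nodup_append']
    exact ⟨h2, g2, List.disjoint_toFinset_iff_disjoint.mp hST⟩
  · simp [h3]
  · simp [g4]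
  · simp

theorem reverse (hR : ∀ x y, R x y → R y x) (h : PathOn R a b S) : PathOn R b a S := by
  obtain ⟨l, h1, h2, h3, h4, rfl⟩ := h
  refine ⟨l.reverse, ?_, by simpa, by simpa, by simpa, by simp⟩
  rw [List.isChain_reverse]
  exact h1.imp fun x y => hR x y

theorem map {R : β → β → Prop} {p : α → β} (h : PathOn (fun i j => R (p i) (p j)) a b S)
    (hp : Set.InjOn p S) : PathOn R (p a) (p b) (S.image p) := by
  obtain ⟨l, h1, h2, h3, h4, rfl⟩ := h
  refine ⟨l.map p, ?_, ?_, by simp [h3], by simp [h4], by ext; simp⟩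
  · rwa [List.isChain_map]
  · exact h2.map_on fun x hx y hy => hp (by simpa using hx) (by simpa using hy)

theorem Icc {R : ℕ → ℕ → Prop} {a b : ℕ} (hab : a ≤ b)
    (h : ∀ i, a ≤ i → i < b → R i (i + 1)) : PathOn R a b (Finset.Icc a b) := by
  induction b, hab using Nat.le_induction with
  | base => simpa using single R a
  | succ b hb ih =>
    have := (ih fun i h1 h2 => h i h1 (by omega)).append (h b hb (by omega)) (single R (b + 1))
      (by simp)
    convert this using 1
    ext i
    simp
    omega

theorem exists_enum (h : PathOn R a b S) : ∃ p : ℕ → α, (∀ i, i + 1 < S.card → R (p i) (p (i + 1))) ∧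
    Set.InjOn p (range S.card) ∧ (range S.card).image p = S ∧ p 0 = a ∧ p (S.card - 1) = b ∧
    0 < S.card := by
  obtain ⟨l, h1, h2, h3, h4, rfl⟩ := h
  have hl : l.toFinset.card = l.length := List.toFinset_card_of_nodup h2
  have hpos : 0 < l.length := by
    rcases l with _ | ⟨x, l⟩ <;> simp at *
  rw [hl]
  have key : ∀ i (hi : i < l.length), l.getD i a = l[i] := fun i hi => by simp [hi]
  refine ⟨fun i => l.getD i a, ?_, ?_, ?_, ?_, ?_, hpos⟩
  · intro i hi
    simp only [key i (by omega), key (i + 1) hi]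
    exact List.isChain_iff_getElem.mp h1 i hi
  · intro i hi j hj hij
    simp only [coe_range, Set.mem_Iio] at hi hj
    simp only [key i hi, key j hj] at hij
    exact (h2.getElem_inj_iff).mp hij
  · ext x
    simp only [mem_image, Finset.mem_range, List.mem_toFinset, List.mem_iff_getElem]
    constructor
    · rintro ⟨i, hi, rfl⟩
      exact ⟨i, hi, (key i hi).symm⟩
    · rintro ⟨i, hi, rfl⟩
      exact ⟨i, hi, key i hi⟩
  · rw [List.head?_eq_getElem?] at h3
    simp [h3]
  · rw [List.getLast?_eq_getElem?] at h4
    simp [h4]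

end PathOn

theorem Set.InjOn.disjoint_finset_image {α β : Type*} [DecidableEq α] [DecidableEq β] {f : α → β}
    {W : Set α} (hf : Set.InjOn f W) {S T : Finset α} (hS : ↑S ⊆ W) (hT : ↑T ⊆ W)
    (h : Disjoint S T) : Disjoint (S.image f) (T.image f) := by
  rw [Finset.disjoint_left] at h ⊢
  simp only [Finset.mem_image]
  rintro _ ⟨x, hx, rfl⟩ ⟨y, hy, hxy⟩
  exact h hx (hf (hT hy) (hS hx) hxy ▸ hy)

/-- `G` has a spanning path of some `N`-set whose ends are adjacent. -/
def HasClosedPath {V : Type*} [DecidableEq V] (G : SimpleGraph V) (N : ℕ) : Prop :=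
  ∃ a b S, PathOn G.Adj a b S ∧ G.Adj b a ∧ S.card = N

theorem HasClosedPath.isHamiltonian {V : Type*} [Fintype V] [DecidableEq V] {G : SimpleGraph V}
    (hV : 3 ≤ Fintype.card V) (h : HasClosedPath G (Fintype.card V)) : G.IsHamiltonian := by
  obtain ⟨a, b, S, ⟨l, h1, h2, h3, h4, rfl⟩, hba, hS⟩ := h
  rw [List.toFinset_card_of_nodup h2] at hS
  intro _
  have hne : l ≠ [] := by rintro rfl; simp at h3
  obtain rfl : l.head hne = a := by rw [List.head?_eq_some_head hne] at h3; simpa using h3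
  obtain rfl : l.getLast hne = b := by rw [List.getLast?_eq_some_getLast hne] at h4; simpa using h4
  have hp : (Walk.ofSupport l hne h1).IsPath := by
    rw [Walk.isPath_def, Walk.support_ofSupport]; exact h2
  have hlen := Walk.length_ofSupport (G := G) hne h1
  refine ⟨_, Walk.cons hba (Walk.ofSupport l hne h1), ?_⟩
  rw [Walk.isHamiltonianCycle_iff_isCycle_and_length_eq]
  refine ⟨?_, by simp [hlen]; omega⟩
  rw [Walk.cons_isCycle_iff]
  refine ⟨hp, fun hmem => ?_⟩
  have := hp.length_eq_one_of_mem_edges (Sym2.eq_swap ▸ hmem)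
  omega

/-- A cyclic enumeration of an `N`-cycle of `G`. -/
structure IsCyclicEnum {V : Type*} (G : SimpleGraph V) (N : ℕ) (c : ℕ → V) : Prop where
  adj : ∀ i, G.Adj (c i) (c (i + 1))
  periodic : ∀ i, c (i + N) = c i
  ne : ∀ i j, i < j → j < i + N → c i ≠ c j

namespace IsCyclicEnum

variable {V : Type*} [DecidableEq V] {G : SimpleGraph V} {N : ℕ} {c : ℕ → V}

omit [DecidableEq V] in
theorem injOn (h : IsCyclicEnum G N c) {W : Finset ℕ} (a : ℕ)
    (hW : ∀ i ∈ W, a ≤ i ∧ i < a + N) : Set.InjOn c W := by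
  intro i hi j hj hij
  have h1 := hW i hi
  have h2 := hW j hj
  rcases lt_trichotomy i j with hlt | heq | hlt
  · exact absurd hij (h.ne i j hlt (by omega))
  · exact heq
  · exact absurd hij.symm (h.ne j i hlt (by omega))

theorem pathOn (h : IsCyclicEnum G N c) {a b : ℕ} (hab : a ≤ b) (hb : b < a + N) :
    PathOn G.Adj (c a) (c b) ((Finset.Icc a b).image c) :=
  PathOn.map (R := G.Adj) (PathOn.Icc hab fun i _ _ => h.adj i)
    (h.injOn a (by simp; omega))

theorem card_image_Icc (h : IsCyclicEnum G N c) {a b : ℕ} (hab : a ≤ b) (hb : b < a + N) :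
    ((Finset.Icc a b).image c).card = b - a + 1 := by
  rw [Finset.card_image_of_injOn (h.injOn a (by simp; omega))]
  simp
  omega

omit [DecidableEq V] in
theorem exists_eq_of_pos (h : IsCyclicEnum G N c) (hN : 0 < N) (a i : ℕ) :
    ∃ j, a ≤ j ∧ j < a + N ∧ c j = c i := by
  have hper : ∀ k i, c (i + N * k) = c i := by
    intro k
    induction k with
    | zero => simp
    | succ k ih => intro i; rw [Nat.mul_succ, ← add_assoc, h.periodic, ih]
  have hmod : ∀ i, c i = c (i % N) := fun i => by
    conv_lhs => rw [← Nat.mod_add_div i N]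
    exact hper _ _
  refine ⟨a + (i + N * a - a) % N, by omega, by have := Nat.mod_lt (i + N * a - a) hN; omega, ?_⟩
  have : a ≤ N * a := Nat.le_mul_of_pos_left a hN
  rw [hmod, Nat.add_mod_mod, show a + (i + N * a - a) = i + N * a by omega, ← hmod, hper]

end IsCyclicEnum

theorem PathOn.exists_isCyclicEnum {V : Type*} [DecidableEq V] {G : SimpleGraph V} {a b : V}
    {S : Finset V} (h : PathOn G.Adj a b S) (hba : G.Adj b a) :
    ∃ c, IsCyclicEnum G S.card c ∧ (range S.card).image c = S := by
  obtain ⟨p, h1, h2, h3, rfl, rfl, h6⟩ := h.exists_enum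
  set N := S.card with hN
  refine ⟨fun i => p (i % N), ⟨?_, by simp, ?_⟩, ?_⟩
  · intro i
    have hi := Nat.mod_lt i h6
    by_cases hlt : i % N + 1 < N
    · have : (i + 1) % N = i % N + 1 := by
        rw [Nat.add_mod_eq_ite, Nat.mod_eq_of_lt (show 1 < N by omega)]
        grind
      simp only [this]
      exact h1 _ hlt
    · have h7 : i % N = N - 1 := by omega
      have : (i + 1) % N = 0 := by
        rw [Nat.add_mod, h7]
        rcases Nat.lt_or_ge 1 N with h8 | h8
        · rw [Nat.mod_eq_of_lt h8, show N - 1 + 1 = N by omega, Nat.mod_self]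
        · simp [show N = 1 by omega]
      simp only [this, h7]
      exact hba
  · intro i j hij hj heq
    have := h2 (by simpa using Nat.mod_lt i h6) (by simpa using Nat.mod_lt j h6) heq
    have h8 : (j - i) % N = 0 := Nat.sub_mod_eq_zero_of_mod_eq this.symm
    rw [Nat.mod_eq_of_lt (by omega)] at h8
    omega
  · conv_rhs => rw [← h3]
    refine Finset.image_congr fun i hi => ?_
    simp only [coe_range, Set.mem_Iio] at hi
    simp [Nat.mod_eq_of_lt hi]

theorem exists_adj_of_not_connectivityAtMostOne {V : Type*} {G : SimpleGraph V}
    (h : ¬ ConnectivityAtMostOne G) {S : Set V} (hS : S.ncard ≤ 1) {A : Set V} {a b : V}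
    (ha : a ∈ A) (haS : a ∉ S) (hb : b ∉ A) (hbS : b ∉ S) :
    ∃ u v, u ∈ A ∧ u ∉ S ∧ v ∉ A ∧ v ∉ S ∧ G.Adj u v := by
  have hc : (G.induce Sᶜ).Connected := by
    by_contra hc
    exact h ⟨S, hS, hc⟩
  obtain ⟨w⟩ := hc.preconnected ⟨a, haS⟩ ⟨b, hbS⟩
  obtain ⟨d, -, h1, h2⟩ := w.exists_boundary_dart (Subtype.val ⁻¹' A) ha hb
  exact ⟨_, _, h1, d.fst.2, h2, d.snd.2, d.adj⟩

theorem degree_le_card_filter_add {V : Type*} [Fintype V] [DecidableEq V] {G : SimpleGraph V}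
    [DecidableRel G.Adj] {v : V} {p : ℕ → V} {W : Finset ℕ} {T : Finset V}
    (h : ∀ w, G.Adj v w → w ∈ W.image p ∨ w ∈ T) :
    G.degree v ≤ (W.filter fun i => G.Adj v (p i)).card + T.card := by
  rw [← G.card_neighborFinset_eq_degree]
  calc (G.neighborFinset v).card
      ≤ ((W.filter fun i => G.Adj v (p i)).image p ∪ T).card := by
        refine card_le_card fun w hw => ?_
        rw [G.mem_neighborFinset] at hw
        rw [mem_union]
        refine (h w hw).imp_left fun hm => ?_
        rw [mem_image] at hm ⊢
        obtain ⟨i, hi, rfl⟩ := hm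
        exact ⟨i, mem_filter.mpr ⟨hi, hw⟩, rfl⟩
    _ ≤ _ := (card_union_le _ _).trans (by gcongr; exact card_image_le)

section IndepSets

variable {V : Type*} [DecidableEq V] {G : SimpleGraph V} {N : ℕ}

theorem indep_insert_image_succ {p : ℕ → V} {z : V} {I : Finset ℕ}
    (hinj : Set.InjOn (fun i => p (i + 1)) I) (hz : ∀ i ∈ I, z ≠ p (i + 1))
    (h1 : ∀ i ∈ I, ¬ G.Adj z (p (i + 1)))
    (h2 : ∀ i ∈ I, ∀ j ∈ I, i < j → ¬ G.Adj (p (i + 1)) (p (j + 1))) :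
    ∃ s : Finset V, s.card = I.card + 1 ∧ ∀ u ∈ s, ∀ v ∈ s, u ≠ v → ¬ G.Adj u v := by
  refine ⟨insert z (I.image fun i => p (i + 1)), ?_, ?_⟩
  · rw [card_insert_of_notMem, card_image_of_injOn hinj]
    simp only [mem_image, not_exists, not_and]
    exact fun i hi h => hz i hi h.symm
  · intro u hu v hv huv hadj
    simp only [mem_insert, mem_image] at hu hv
    rcases hu with rfl | ⟨i, hi, rfl⟩ <;> rcases hv with rfl | ⟨j, hj, rfl⟩
    · exact huv rfl
    · exact h1 j hj hadj
    · exact h1 i hi hadj.symm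
    · rcases lt_trichotomy i j with hlt | rfl | hlt
      · exact h2 i hi j hj hlt hadj
      · exact huv rfl
      · exact h2 j hj i hi hlt hadj.symm

theorem IsCyclicEnum.exists_indep [DecidableRel G.Adj] {c : ℕ → V} (hc : IsCyclicEnum G N c) {z : V}
    (hz : ∀ i, z ≠ c i) (hno : ¬ HasClosedPath G (N + 1)) :
    ∃ s : Finset V, s.card = ((range N).filter fun i => G.Adj z (c i)).card + 1 ∧
      ∀ u ∈ s, ∀ v ∈ s, u ≠ v → ¬ G.Adj u v := by
  have hzI : ∀ W : Finset ℕ, z ∉ W.image c := fun W h => by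
    obtain ⟨i, -, h⟩ := mem_image.mp h
    exact hz i h.symm
  apply indep_insert_image_succ
  · intro i hi j hj hij
    have hi' := mem_range.mp (mem_filter.mp hi).1
    have hj' := mem_range.mp (mem_filter.mp hj).1
    have := hc.injOn (W := Finset.Icc 1 N) 1 (by simp; omega) (by simp; omega) (by simp; omega) hij
    omega
  · exact fun i _ => hz _
  · intro i hi h
    obtain ⟨hi, hzi⟩ := mem_filter.mp hi
    have hi := mem_range.mp hi
    refine hno ⟨_, _, _, (hc.pathOn (a := i + 1) (b := i + N) (by omega) (by omega)).append
      (c := z) (by rw [hc.periodic]; exact hzi.symm) (PathOn.single _ z)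
      (disjoint_singleton_right.mpr (hzI _)), h, ?_⟩
    rw [card_union_of_disjoint (disjoint_singleton_right.mpr (hzI _)), hc.card_image_Icc (by omega) (by omega)]
    simp
    omega
  · intro i hi j hj hij h
    obtain ⟨hi, hzi⟩ := mem_filter.mp hi
    obtain ⟨hj, hzj⟩ := mem_filter.mp hj
    have hi := mem_range.mp hi
    have hj := mem_range.mp hj
    have d1 : Disjoint ((Finset.Icc (j + 1) (i + N)).image c) {z} := disjoint_singleton_right.mpr (hzI _)
    have d2 : Disjoint ((Finset.Icc (j + 1) (i + N)).image c ∪ {z})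
        ((Finset.Icc (i + 1) j).image c) := by
      rw [disjoint_union_left]
      refine ⟨?_, disjoint_singleton_left.mpr (hzI _)⟩
      refine (hc.injOn (W := Finset.Icc (i + 1) (i + N)) (i + 1)
        (by simp; omega)).disjoint_finset_image ?_ ?_ ?_
      · intro x; simp; omega
      · intro x; simp; omega
      · rw [Finset.disjoint_left]; intro x; simp; omega
    refine hno ⟨_, _, _, ((hc.pathOn (a := j + 1) (b := i + N) (by omega) (by omega)).append
      (by rw [hc.periodic]; exact hzi.symm) (PathOn.single _ z) d1).append hzj
      ((hc.pathOn (a := i + 1) (b := j) (by omega) (by omega)).reverse fun _ _ => Adj.symm) d2,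
      h, ?_⟩
    rw [card_union_of_disjoint d2, card_union_of_disjoint d1,
      hc.card_image_Icc (by omega) (by omega), hc.card_image_Icc (by omega) (by omega)]
    simp
    omega

theorem exists_indep_of_path [DecidableRel G.Adj] {p : ℕ → V} (hadj : ∀ i, i + 1 < N → G.Adj (p i) (p (i + 1)))
    (hinj : Set.InjOn p (range N)) (hN : 0 < N) {z : V} (hz : ∀ i < N, z ≠ p i)
    (hno : ¬ ∃ a b S, PathOn G.Adj a b S ∧ S.card = N + 1) :
    ∃ s : Finset V, s.card = ((range N).filter fun i => G.Adj z (p i)).card + 1 ∧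
      ∀ u ∈ s, ∀ v ∈ s, u ≠ v → ¬ G.Adj u v := by
  have slice : ∀ a b, a ≤ b → b < N → PathOn G.Adj (p a) (p b) ((Finset.Icc a b).image p) := by
    intro a b hab hb
    refine PathOn.map (R := G.Adj) (PathOn.Icc hab fun i _ _ => hadj i (by omega))
      (hinj.mono ?_)
    intro x; simp; omega
  have hcard : ∀ a b, b < N → ((Finset.Icc a b).image p).card = b + 1 - a := by
    intro a b hb
    rw [card_image_of_injOn, Nat.card_Icc]
    refine hinj.mono ?_
    intro x; simp; omega
  have hzI : ∀ a b, b < N → z ∉ (Finset.Icc a b).image p := fun a b hb h => by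
    obtain ⟨i, hi, h⟩ := mem_image.mp h
    exact hz i (by simp at hi; omega) h.symm
  have hdisj : ∀ a b a' b', b < a' → b' < N →
      Disjoint ((Finset.Icc a b).image p) ((Finset.Icc a' b').image p) := by
    intro a b a' b' h1 h2
    by_cases hle : a' ≤ b'
    · refine hinj.disjoint_finset_image ?_ ?_ ?_
      · intro x; simp; omega
      · intro x; simp; omega
      · rw [Finset.disjoint_left]; intro x; simp; omega
    · simp [Finset.Icc_eq_empty hle]
  have hlast : ∀ i < N, G.Adj z (p i) → i + 1 < N := by
    intro i hi hzi
    by_contra hlt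
    obtain rfl : i = N - 1 := by omega
    have d : Disjoint ((Finset.Icc 0 (N - 1)).image p) {z} := by simpa using hzI 0 _ hi
    refine hno ⟨_, _, _, (slice 0 (N - 1) (by omega) hi).append hzi.symm (PathOn.single _ z) d, ?_⟩
    rw [card_union_of_disjoint d, hcard _ _ hi]
    simp
    omega
  apply indep_insert_image_succ
  · intro i hi j hj hij
    obtain ⟨hi, hzi⟩ := mem_filter.mp hi
    obtain ⟨hj, hzj⟩ := mem_filter.mp hj
    have := hinj (by simpa using hlast i (mem_range.mp hi) hzi)
      (by simpa using hlast j (mem_range.mp hj) hzj) hij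
    omega
  · intro i hi
    obtain ⟨hi, hzi⟩ := mem_filter.mp hi
    exact hz _ (hlast i (mem_range.mp hi) hzi)
  · intro i hi h
    obtain ⟨hi, hzi⟩ := mem_filter.mp hi
    have hi := hlast i (mem_range.mp hi) hzi
    have d1 : Disjoint ((Finset.Icc 0 i).image p) {z} := by simpa using hzI 0 i (by omega)
    have d2 : Disjoint ((Finset.Icc 0 i).image p ∪ {z}) ((Finset.Icc (i + 1) (N - 1)).image p) := by
      rw [disjoint_union_left]
      exact ⟨hdisj _ _ _ _ (by omega) (by omega), by simpa using hzI (i + 1) (N - 1) (by omega)⟩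
    refine hno ⟨_, _, _, ((slice 0 i (by omega) (by omega)).append hzi.symm
      (PathOn.single _ z) d1).append h (slice (i + 1) (N - 1) (by omega) (by omega)) d2, ?_⟩
    rw [card_union_of_disjoint d2, card_union_of_disjoint d1, hcard _ _ (by omega),
      hcard _ _ (by omega)]
    simp
    omega
  · intro i hi j hj hij h
    obtain ⟨hi, hzi⟩ := mem_filter.mp hi
    obtain ⟨hj, hzj⟩ := mem_filter.mp hj
    have hi := hlast i (mem_range.mp hi) hzi
    have hj := hlast j (mem_range.mp hj) hzj
    have d1 : Disjoint ((Finset.Icc 0 i).image p) {z} := by simpa using hzI 0 i (by omega)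
    have d2 : Disjoint ((Finset.Icc 0 i).image p ∪ {z}) ((Finset.Icc (i + 1) j).image p) := by
      rw [disjoint_union_left]
      exact ⟨hdisj _ _ _ _ (by omega) (by omega), by simpa using hzI (i + 1) j (by omega)⟩
    have d3 : Disjoint ((Finset.Icc 0 i).image p ∪ {z} ∪ (Finset.Icc (i + 1) j).image p)
        ((Finset.Icc (j + 1) (N - 1)).image p) := by
      rw [disjoint_union_left, disjoint_union_left]
      exact ⟨⟨hdisj _ _ _ _ (by omega) (by omega), by simpa using hzI (j + 1) (N - 1) (by omega)⟩,
        hdisj _ _ _ _ (by omega) (by omega)⟩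
    refine hno ⟨_, _, _, (((slice 0 i (by omega) (by omega)).append hzi.symm
      (PathOn.single _ z) d1).append hzj
      ((slice (i + 1) j (by omega) (by omega)).reverse fun _ _ => Adj.symm) d2).append h
      (slice (j + 1) (N - 1) (by omega) (by omega)) d3, ?_⟩
    rw [card_union_of_disjoint d3, card_union_of_disjoint d2, card_union_of_disjoint d1,
      hcard _ _ (by omega), hcard _ _ (by omega), hcard _ _ (by omega)]
    simp
    omega

end IndepSets

/-- Two adjacent vertices off a longest cycle have few neighbours on it. -/
theorem IsCyclicEnum.card_filter_add_le {V : Type*} [DecidableEq V] {G : SimpleGraph V}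
    [DecidableRel G.Adj] {N : ℕ} {c : ℕ → V} (hN : 3 ≤ N) (hc : IsCyclicEnum G N c) {x y : V}
    (hx : ∀ i, x ≠ c i) (hy : ∀ i, y ≠ c i) (hxy : G.Adj x y)
    (hno1 : ¬ HasClosedPath G (N + 1)) (hno2 : ¬ HasClosedPath G (N + 2)) :
    ((range N).filter fun i => G.Adj x (c i)).card +
      2 * ((range N).filter fun i => G.Adj y (c i)).card ≤ N := by
  have off : ∀ {z : V}, (∀ i, z ≠ c i) → ∀ W : Finset ℕ, z ∉ W.image c := fun hz W h => by
    obtain ⟨i, -, h⟩ := mem_image.mp h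
    exact hz i h.symm
  have hyy : ∀ i, G.Adj y (c i) → ¬ G.Adj y (c (i + 1)) := by
    intro i h1 h2
    have d : Disjoint ((Finset.Icc (i + 1) (i + N)).image c) {y} :=
      disjoint_singleton_right.mpr (off hy _)
    refine hno1 ⟨_, _, _, (hc.pathOn (a := i + 1) (b := i + N) (by omega) (by omega)).append
      (by rw [hc.periodic]; exact h1.symm) (PathOn.single _ y) d, h2, ?_⟩
    rw [card_union_of_disjoint d, hc.card_image_Icc (by omega) (by omega)]
    simp
    omega
  have close : ∀ i d, 1 ≤ d → d ≤ 2 → G.Adj y (c i) → ¬ G.Adj x (c (i + d)) := by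
    intro i d hd1 hd2 h1 h2
    have d1 : Disjoint ((Finset.Icc (i + d) (i + N)).image c) {y} :=
      disjoint_singleton_right.mpr (off hy _)
    have d2 : Disjoint ((Finset.Icc (i + d) (i + N)).image c ∪ {y}) {x} := by
      rw [disjoint_union_left]
      exact ⟨disjoint_singleton_right.mpr (off hx _), by simpa using hxy.ne'⟩
    have hclosed : HasClosedPath G (N - d + 3) := by
      refine ⟨_, _, _, ((hc.pathOn (a := i + d) (b := i + N) (by omega) (by omega)).append
        (by rw [hc.periodic]; exact h1.symm) (PathOn.single _ y) d1).append hxy.symm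
        (PathOn.single _ x) d2, h2, ?_⟩
      rw [card_union_of_disjoint d2, card_union_of_disjoint d1,
        hc.card_image_Icc (by omega) (by omega)]
      simp
      omega
    obtain rfl | rfl : d = 1 ∨ d = 2 := by omega
    · exact hno2 (by convert hclosed using 1; omega)
    · exact hno1 (by convert hclosed using 1; omega)
  set I := (range N).filter fun i => G.Adj x (c i) with hI
  set J := (range N).filter fun i => G.Adj y (c i) with hJ
  have card_shift : ∀ K ⊆ range N, ∀ d, (K.image fun i => c (i + d)).card = K.card := by
    intro K hK d
    refine card_image_of_injOn fun i hi j hj hij => ?_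
    have h1 := mem_range.mp (hK hi)
    have h2 := mem_range.mp (hK hj)
    have := hc.injOn (W := Finset.Ico d (d + N)) d (by simp) (by simp; omega) (by simp; omega) hij
    omega
  have hshift : ∀ K : Finset ℕ, ∀ d, (K.image fun i => c (i + d)) ⊆ (range N).image c := by
    intro K d w hw
    obtain ⟨i, -, rfl⟩ := mem_image.mp hw
    obtain ⟨j, -, h2, h3⟩ := hc.exists_eq_of_pos (by omega) 0 (i + d)
    exact mem_image.mpr ⟨j, by simpa using h2, h3⟩
  have hd : ∀ d, 1 ≤ d → d ≤ 2 →
      Disjoint (I.image fun i => c (i + 0)) (J.image fun i => c (i + d)) := by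
    intro d h1 h2
    rw [Finset.disjoint_left]
    intro w hw hw'
    obtain ⟨i, hi, rfl⟩ := mem_image.mp hw
    obtain ⟨j, hj, hji⟩ := mem_image.mp hw'
    refine close j d h1 h2 (mem_filter.mp hj).2 ?_
    rw [hji]
    exact (mem_filter.mp hi).2
  have hJJ : Disjoint (J.image fun i => c (i + 1)) (J.image fun i => c (i + 2)) := by
    rw [Finset.disjoint_left]
    intro w hw hw'
    obtain ⟨i, hi, rfl⟩ := mem_image.mp hw
    obtain ⟨j, hj, hji⟩ := mem_image.mp hw'
    have hi1 := mem_range.mp (mem_filter.mp hi).1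
    have hj1 := mem_range.mp (mem_filter.mp hj).1
    have : c (j + 1) = c i := by
      by_contra hne
      obtain ⟨a, ha1, ha2, ha3⟩ := hc.exists_eq_of_pos (by omega) (j + 1) i
      have h1 : c (a + 1) = c (j + 2) := by
        rw [hji]
        rcases Nat.lt_or_ge i (j + 1) with h | h
        · have : a = i + N := by
            have := hc.injOn (W := Finset.Ico (j + 1) (j + 1 + N)) (j + 1) (by simp)
              (x₁ := a) (by simp; omega) (x₂ := i + N) (by simp; omega)
              (by rw [ha3, hc.periodic])
            exact this
          rw [this, show i + N + 1 = i + 1 + N by omega, hc.periodic]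
        · have : a = i := hc.injOn (W := Finset.Ico (j + 1) (j + 1 + N)) (j + 1) (by simp)
              (x₁ := a) (by simp; omega) (x₂ := i) (by simp; omega) ha3
          rw [this]
      rcases Nat.lt_or_ge (a + 1) (j + 1 + N) with h | h
      · have := hc.injOn (W := Finset.Ico (j + 1) (j + 1 + N)) (j + 1) (by simp)
              (x₁ := a + 1) (by simp; omega) (x₂ := j + 2) (by simp; omega) h1
        obtain rfl : a = j + 1 := by omega
        exact hne ha3
      · have h2 : a + 1 = j + 1 + N := by omega
        rw [h2, hc.periodic] at h1
        exact hc.ne (j + 1) (j + 2) (by omega) (by omega) h1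
    refine hyy j (mem_filter.mp hj).2 ?_
    rw [this]
    exact (mem_filter.mp hi).2
  have hle := card_le_card (union_subset (union_subset (hshift I 0) (hshift J 1)) (hshift J 2))
  rw [card_union_of_disjoint (disjoint_union_left.mpr ⟨hd 2 (by omega) (by omega), hJJ⟩),
    card_union_of_disjoint (hd 1 (by omega) (by omega)), card_shift I (filter_subset _ _),
    card_shift J (filter_subset _ _), card_shift J (filter_subset _ _)] at hle
  have := hle.trans card_image_le
  rw [card_range] at this
  omega

theorem not_adj_ends_of_short_crossing {n m : ℕ} {R : ℕ → ℕ → Prop}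
    (hsymm : ∀ x y, R x y → R y x) (hstep : ∀ i, i + 1 < n → R i (i + 1))
    (hno : ∀ a b S, PathOn R a b S → S ⊆ range n → m ≤ S.card → ¬ R b a)
    {i j : ℕ} (hij : i ≤ j) (hji : j + m ≤ i + n)
    (hjn : j + 1 < n) (hi : R (n - 1) i) : ¬ R 0 (j + 1) := by
  intro hj
  have d : Disjoint (Finset.Icc 0 i) (Finset.Icc (j + 1) (n - 1)) := by
    rw [Finset.disjoint_left]; intro x; simp; omega
  refine hno _ _ _ ((PathOn.Icc (Nat.zero_le i) fun k _ _ => hstep k (by omega)).append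
    (hsymm _ _ hi) ((PathOn.Icc (show j + 1 ≤ n - 1 by omega)
      fun k _ _ => hstep k (by omega)).reverse hsymm) d) ?_ ?_ (hsymm _ _ hj)
  · intro x; simp; omega
  · rw [card_union_of_disjoint d]; simp; omega

section PathRotations

variable {n : ℕ} {R : ℕ → ℕ → Prop} (hsymm : ∀ x y, R x y → R y x)
  (hstep : ∀ i, i + 1 < n → R i (i + 1))
  (hno : ∀ a b S, PathOn R a b S → S ⊆ range n → n - 2 ≤ S.card → ¬ R b a)
include hsymm hstep hno

theorem not_adj_ends_of_chord {a b e f : ℕ} (hae : a < e) (hef : e ≤ f) (hfb : f < b) (hb : b < n)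
    (hgap : e + b ≤ a + f + 4) (hab : R a b) (he : R 0 e) : ¬ R (n - 1) f := by
  intro hf
  have d1 : Disjoint (Finset.Icc 0 a) (Finset.Icc b (n - 1)) := by
    rw [Finset.disjoint_left]; intro x; simp; omega
  have d2 : Disjoint (Finset.Icc 0 a ∪ Finset.Icc b (n - 1)) (Finset.Icc e f) := by
    rw [Finset.disjoint_left]; intro x; simp; omega
  refine hno _ _ _ (((PathOn.Icc (Nat.zero_le a) fun k _ _ => hstep k (by omega)).append
    hab (PathOn.Icc (show b ≤ n - 1 by omega) fun k _ _ => hstep k (by omega)) d1).append hf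
    ((PathOn.Icc hef fun k _ _ => hstep k (by omega)).reverse hsymm) d2) ?_ ?_ (hsymm _ _ he)
  · intro x; simp; omega
  · rw [card_union_of_disjoint d2, card_union_of_disjoint d1]; simp; omega

theorem not_adj_ends_of_two_chords {a s b : ℕ} (has : a < s) (hsb : s + 1 < b) (hb : b < n)
    (ha : R a (s + 1)) (hsb' : R s b) (h0 : R 0 (a + 1)) : ¬ R (n - 1) (b - 1) := by
  intro h1
  have d1 : Disjoint (Finset.Icc 0 a) (Finset.Icc (s + 1) (b - 1)) := by
    rw [Finset.disjoint_left]; intro x; simp; omega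
  have d2 : Disjoint (Finset.Icc 0 a ∪ Finset.Icc (s + 1) (b - 1)) (Finset.Icc b (n - 1)) := by
    rw [Finset.disjoint_left]; intro x; simp; omega
  have d3 : Disjoint (Finset.Icc 0 a ∪ Finset.Icc (s + 1) (b - 1) ∪ Finset.Icc b (n - 1))
      (Finset.Icc (a + 1) s) := by
    rw [Finset.disjoint_left]; intro x; simp; omega
  refine hno _ _ _ ((((PathOn.Icc (Nat.zero_le a) fun k _ _ => hstep k (by omega)).append
    ha (PathOn.Icc (show s + 1 ≤ b - 1 by omega) fun k _ _ => hstep k (by omega)) d1).append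
    (hsymm _ _ h1) ((PathOn.Icc (show b ≤ n - 1 by omega)
      fun k _ _ => hstep k (by omega)).reverse hsymm) d2).append (hsymm _ _ hsb')
    ((PathOn.Icc (show a + 1 ≤ s by omega) fun k _ _ => hstep k (by omega)).reverse hsymm) d3)
    ?_ ?_ (hsymm _ _ h0)
  · intro x; simp; omega
  · rw [card_union_of_disjoint d3, card_union_of_disjoint d2, card_union_of_disjoint d1]
    simp; omega

theorem not_adj_ends_of_crossing
    (hmiss : ∀ i j, i + 1 < n → j + 1 < n → ¬ R 0 (i + 1) → ¬ R (n - 1) i →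
      ¬ R 0 (j + 1) → ¬ R (n - 1) j → i = j)
    (d : ℕ) : ∀ i j, j = i + d → j + 1 < n → R (n - 1) i → ¬ R 0 (j + 1) := by
  induction d using Nat.strong_induction_on with
  | _ d ih =>
    intro i j hj hjn hi h0
    by_cases hd : d ≤ 2
    · exact not_adj_ends_of_short_crossing hsymm hstep hno (by omega) (by omega) hjn hi h0
    have key : ∀ e, 1 ≤ e → e ≤ 2 → ¬ R 0 (i + e + 1) ∧ ¬ R (n - 1) (i + e) := by
      intro e h1 h2
      exact ⟨ih e (by omega) i (i + e) rfl (by omega) hi,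
        fun h => ih (d - e) (by omega) (i + e) j (by omega) hjn h h0⟩
    have h1 := key 1 (by omega) (by omega)
    have h2 := key 2 (by omega) (by omega)
    have := hmiss (i + 1) (i + 2) (by omega) (by omega) h1.1 h1.2 h2.1 h2.2
    omega

theorem false_of_no_long_closed_path (hn : 3 ≤ n)
    (hmiss : ∀ i j, i + 1 < n → j + 1 < n → ¬ R 0 (i + 1) → ¬ R (n - 1) i →
      ¬ R 0 (j + 1) → ¬ R (n - 1) j → i = j)
    (hcut : ∀ s, 0 < s → s + 1 < n → ∃ a b, a < s ∧ s < b ∧ b < n ∧ R a b) : False := by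
  classical
  have hcross : ∀ i j, i ≤ j → j + 1 < n → R (n - 1) i → ¬ R 0 (j + 1) := fun i j hij =>
    not_adj_ends_of_crossing hsymm hstep hno hmiss (j - i) i j (by omega)
  have h01 : R 0 1 := hstep 0 (by omega)
  have hlast : R (n - 1) (n - 2) := hsymm _ _ (by
    have := hstep (n - 2) (by omega)
    rwa [show n - 2 + 1 = n - 1 by omega] at this)
  have h0n : ¬ R 0 (n - 1) := by
    have := hcross (n - 2) (n - 2) le_rfl (by omega) hlast
    rwa [show n - 2 + 1 = n - 1 by omega] at this
  obtain ⟨s, hs1, hs2, hs3, hsmax⟩ : ∃ s, 0 < s ∧ s + 1 < n ∧ R 0 s ∧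
      ∀ i, s < i → i < n → ¬ R 0 i := by
    have hP : ∃ k, k + 1 ≤ n ∧ R 0 (n - 1 - k) ∧ 0 < n - 1 - k :=
      ⟨n - 2, by omega, by rwa [show n - 1 - (n - 2) = 1 by omega], by omega⟩
    obtain ⟨g1, g2, g3⟩ := Nat.find_spec hP
    refine ⟨n - 1 - Nat.find hP, g3, ?_, g2, fun i hi hin h => ?_⟩
    · rcases Nat.eq_zero_or_pos (Nat.find hP) with h0 | h0
      · rw [h0] at g2
        exact absurd g2 h0n
      · omega
    · refine Nat.find_min hP (m := n - 1 - i) (by omega) ⟨by omega, ?_, by omega⟩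
      rwa [show n - 1 - (n - 1 - i) = i by omega]
  obtain ⟨t, ht2, ht3, htmin⟩ : ∃ t, t + 1 < n ∧ R (n - 1) t ∧ ∀ i < t, ¬ R (n - 1) i := by
    have hP : ∃ k, k + 1 < n ∧ R (n - 1) k := ⟨n - 2, by omega, hlast⟩
    obtain ⟨g1, g2⟩ := Nat.find_spec hP
    exact ⟨_, g1, g2, fun i hi h => Nat.find_min hP hi ⟨by omega, h⟩⟩
  have hst : s ≤ t := by
    by_contra hlt
    refine hcross t (s - 1) (by omega) (by omega) ht3 ?_
    rwa [show s - 1 + 1 = s by omega]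
  have hts : t ≤ s + 1 := by
    by_contra hlt
    have := hmiss s (s + 1) (by omega) (by omega) (hsmax _ (by omega) (by omega))
      (htmin _ (by omega)) (hsmax _ (by omega) (by omega)) (htmin _ (by omega))
    omega
  have hnB : ∀ i < t, ¬ R (n - 1) i := htmin
  have hnA : ∀ i, s ≤ i → i + 1 < n → ¬ R 0 (i + 1) := fun i h1 h2 => hsmax _ (by omega) h2
  obtain ⟨a, b, has, hsb, hbn, hab⟩ := hcut s hs1 hs2
  rcases Nat.lt_or_ge s t with hlt | hge
  · obtain rfl : t = s + 1 := by omega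
    have hA : ∀ i < s, R 0 (i + 1) := by
      intro i hi
      by_contra h
      have := hmiss i s (by omega) hs2 h (hnB _ (by omega)) (hnA _ le_rfl hs2) (hnB _ (by omega))
      omega
    have hB : ∀ i, s + 1 ≤ i → i + 1 < n → R (n - 1) i := by
      intro i hi hin
      by_contra h
      have := hmiss i s hin hs2 (hnA _ (by omega) hin) h (hnA _ le_rfl hs2) (hnB _ (by omega))
      omega
    by_cases hb : b = s + 1
    · subst hb
      obtain ⟨a', b', has', hsb', hbn', hab'⟩ := hcut (s + 1) (by omega) ht2
      by_cases ha' : a' = s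
      · subst ha'
        exact not_adj_ends_of_two_chords hsymm hstep hno has hsb' hbn' hab hab' (hA a has)
          (hB _ (by omega) (by omega))
      · exact not_adj_ends_of_chord hsymm hstep hno (a := a') (b := b') (e := a' + 1)
          (f := b' - 1) (by omega) (by omega) (by omega) hbn' (by omega) hab' (hA _ (by omega))
          (hB _ (by omega) (by omega))
    · exact not_adj_ends_of_chord hsymm hstep hno (a := a) (b := b) (e := a + 1)
        (f := b - 1) (by omega) (by omega) (by omega) hbn (by omega) hab (hA _ (by omega))
        (hB _ (by omega) (by omega))
  · obtain rfl : t = s := by omega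
    by_cases hA : R 0 (a + 1)
    · by_cases hB : R (n - 1) (b - 1)
      · exact not_adj_ends_of_chord hsymm hstep hno (a := a) (b := b) (e := a + 1)
          (f := b - 1) (by omega) (by omega) (by omega) hbn (by omega) hab hA hB
      · have hbt : b - 1 ≠ t := by rintro h; exact hB (h ▸ ht3)
        have hB' : R (n - 1) (b - 2) := by
          by_contra h
          have := hmiss (b - 1) (b - 2) (by omega) (by omega) (hnA _ (by omega) (by omega)) hB
            (hnA _ (by omega) (by omega)) h
          omega
        exact not_adj_ends_of_chord hsymm hstep hno (a := a) (b := b) (e := a + 1)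
          (f := b - 2) (by omega) (by omega) (by omega) hbn (by omega) hab hA hB'
    · have hat : a + 1 ≠ t := by rintro h; exact hA (h ▸ hs3)
      have hA' : R 0 (a + 1 + 1) := by
        by_contra h
        have := hmiss a (a + 1) (by omega) (by omega) hA (hnB _ (by omega)) h (hnB _ (by omega))
        omega
      have hB : R (n - 1) (b - 1) := by
        by_contra h
        have := hmiss a (b - 1) (by omega) (by omega) hA (hnB _ (by omega))
          (hnA _ (by omega) (by omega)) h
        omega
      exact not_adj_ends_of_chord hsymm hstep hno (a := a) (b := b) (e := a + 1 + 1)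
        (f := b - 1) (by omega) (by omega) (by omega) hbn (by omega) hab hA' hB

end PathRotations

section LongPaths

variable {V : Type*} [Fintype V] [DecidableEq V] {G : SimpleGraph V}

theorem PathOn.exists_longer (hconn : ¬ ConnectivityAtMostOne G) {a b : V} {S : Finset V}
    (h : PathOn G.Adj a b S) (hba : G.Adj b a) (hS : S ≠ univ) :
    ∃ a' b' S', PathOn G.Adj a' b' S' ∧ S'.card = S.card + 1 := by
  obtain ⟨c, hc, hcS⟩ := h.exists_isCyclicEnum hba
  have hpos : 0 < S.card := by
    obtain ⟨_, _, _, _, _, _, h6⟩ := h.exists_enum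
    exact h6
  obtain ⟨z, hz⟩ : ∃ z, z ∉ S := by
    by_contra! hall
    exact hS (eq_univ_iff_forall.mpr hall)
  have h0 : c 0 ∈ S := by
    rw [← hcS]
    exact mem_image_of_mem _ (by simpa using hpos)
  obtain ⟨u, v, hu, -, hv, -, huv⟩ := exists_adj_of_not_connectivityAtMostOne hconn (S := ∅)
    (by simp) (A := (S : Set V)) (a := c 0) (b := z) (by simpa using h0) (by simp)
    (by simpa using hz) (by simp)
  rw [mem_coe, ← hcS, mem_image] at hu
  obtain ⟨i, -, rfl⟩ := hu
  have hv : ∀ W : Finset ℕ, v ∉ W.image c := by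
    intro W hW
    obtain ⟨j, -, rfl⟩ := mem_image.mp hW
    obtain ⟨k, -, h2, h3⟩ := hc.exists_eq_of_pos hpos 0 j
    refine hv ?_
    rw [← h3, mem_coe, ← hcS]
    exact mem_image_of_mem _ (by simpa using h2)
  have d : Disjoint ((Finset.Icc (i + 1) (i + S.card)).image c) {v} :=
    disjoint_singleton_right.mpr (hv _)
  refine ⟨_, _, _, (hc.pathOn (a := i + 1) (b := i + S.card) (by omega) (by omega)).append
    (by rw [hc.periodic]; exact huv) (PathOn.single _ v) d, ?_⟩
  rw [card_union_of_disjoint d, hc.card_image_Icc (by omega) (by omega)]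
  simp
  omega

variable [DecidableRel G.Adj]

theorem sum_degrees_add_card_le {N m : ℕ} {p : ℕ → V}
    (hadj : ∀ i, i + 1 < N → G.Adj (p i) (p (i + 1)))
    (hno : ∀ a b S, PathOn (fun i j => G.Adj (p i) (p j)) a b S → S ⊆ range N → m ≤ S.card →
      ¬ G.Adj (p b) (p a)) (hm : m ≤ N)
    (h0 : ∀ w, G.Adj (p 0) w → w ∈ (range N).image p)
    (h1 : ∀ w, G.Adj (p (N - 1)) w → w ∈ (range N).image p)
    {M : Finset ℕ} (hM : ∀ i ∈ M, i + 1 < N ∧ ¬ G.Adj (p 0) (p (i + 1)) ∧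
      ¬ G.Adj (p (N - 1)) (p i)) :
    G.degree (p 0) + G.degree (p (N - 1)) + M.card ≤ N - 1 := by
  have hA : G.degree (p 0) ≤
      ((range (N - 1)).filter fun i => G.Adj (p 0) (p (i + 1))).card + (∅ : Finset V).card := by
    refine degree_le_card_filter_add (p := fun i => p (i + 1)) fun w hw => Or.inl ?_
    obtain ⟨i, hi, rfl⟩ := mem_image.mp (h0 w hw)
    have hi := mem_range.mp hi
    have hne : i ≠ 0 := by rintro rfl; exact hw.ne rfl
    exact mem_image.mpr ⟨i - 1, by simp; omega, by simp only [show i - 1 + 1 = i by omega]⟩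
  have hB : G.degree (p (N - 1)) ≤
      ((range (N - 1)).filter fun i => G.Adj (p (N - 1)) (p i)).card + (∅ : Finset V).card := by
    refine degree_le_card_filter_add fun w hw => Or.inl ?_
    obtain ⟨i, hi, rfl⟩ := mem_image.mp (h1 w hw)
    have hi := mem_range.mp hi
    have hne : i ≠ N - 1 := by rintro rfl; exact hw.ne rfl
    exact mem_image_of_mem _ (by simp; omega)
  set A := (range (N - 1)).filter fun i => G.Adj (p 0) (p (i + 1)) with hAdef
  set B := (range (N - 1)).filter fun i => G.Adj (p (N - 1)) (p i) with hBdef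
  have dAB : Disjoint A B := by
    rw [Finset.disjoint_left]
    intro i hi hi'
    have h2 := mem_filter.mp hi
    have h3 := mem_filter.mp hi'
    have hlt := mem_range.mp h2.1
    exact not_adj_ends_of_short_crossing (R := fun i j => G.Adj (p i) (p j))
      (fun _ _ => Adj.symm) hadj hno (i := i) le_rfl (by omega) (by omega) h3.2 h2.2
  have dM : Disjoint (A ∪ B) M := by
    rw [Finset.disjoint_left]
    intro i hi hi'
    rcases mem_union.mp hi with h | h
    · exact (hM i hi').2.1 (mem_filter.mp h).2
    · exact (hM i hi').2.2 (mem_filter.mp h).2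
  have hsub : A ∪ B ∪ M ⊆ range (N - 1) :=
    union_subset (union_subset (filter_subset _ _) (filter_subset _ _))
      fun i hi => by have := (hM i hi).1; simp; omega
  have := card_le_card hsub
  rw [card_union_of_disjoint dM, card_union_of_disjoint dAB, card_range] at this
  simp only [card_empty] at hA hB
  omega

theorem exists_longest_path (hδ : Fintype.card V ≤ 2 * G.minDegree + 2) [Nonempty V]
    (hconn : ¬ ConnectivityAtMostOne G) :
    ∃ N a b S, PathOn G.Adj a b S ∧ S.card = N ∧ Fintype.card V ≤ N + 1 ∧
      ¬ ∃ a b S, PathOn G.Adj a b S ∧ S.card = N + 1 := by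
  classical
  have hle : ∀ N, (∃ a b S, PathOn G.Adj a b S ∧ S.card = N) → N ≤ Fintype.card V := by
    rintro _ ⟨_, _, S, _, rfl⟩
    exact card_le_univ S
  obtain ⟨v⟩ := ‹Nonempty V›
  obtain ⟨a, b, S, hS, hSN⟩ := Nat.findGreatest_spec
    (P := fun N => ∃ a b S, PathOn G.Adj a b S ∧ S.card = N) (n := Fintype.card V)
    (hle 1 ⟨v, v, {v}, PathOn.single _ v, by simp⟩) ⟨v, v, {v}, PathOn.single _ v, by simp⟩
  have hmax : ¬ ∃ a b S', PathOn G.Adj a b S' ∧ S'.card = S.card + 1 := by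
    intro h
    have := Nat.le_findGreatest (P := fun N => ∃ a b S, PathOn G.Adj a b S ∧ S.card = N) (hle _ h) h
    omega
  refine ⟨S.card, a, b, S, hS, rfl, ?_, hmax⟩
  by_contra! hlt
  have hnoClosed : ∀ a b S', PathOn G.Adj a b S' → S'.card = S.card → ¬ G.Adj b a := by
    intro a b S' h hc hba
    have := h.exists_longer hconn hba (by
      rintro rfl
      rw [card_univ] at hc
      omega)
    rw [hc] at this
    exact hmax this
  have hend : ∀ {a b : V}, PathOn G.Adj a b S → ∀ w, G.Adj b w → w ∈ S := by
    intro a b h w hw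
    by_contra hwS
    have d : Disjoint S {w} := disjoint_singleton_right.mpr hwS
    exact hmax ⟨_, _, _, h.append hw (PathOn.single _ w) d, by rw [card_union_of_disjoint d, card_singleton]⟩
  obtain ⟨p, h1, h2, h3, rfl, rfl, h6⟩ := hS.exists_enum
  have := sum_degrees_add_card_le (m := S.card) h1
    (fun a b S' h hsub hcard => by
      have hinj := h2.mono (show (S' : Set ℕ) ⊆ range S.card by exact_mod_cast hsub)
      refine hnoClosed _ _ _ (h.map (R := G.Adj) hinj) ?_
      rw [card_image_of_injOn hinj]
      have := card_le_card hsub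
      rw [card_range] at this
      omega) le_rfl
    (by rw [h3]; exact hend (hS.reverse fun _ _ => Adj.symm)) (by rw [h3]; exact hend hS)
    (M := ∅) (by simp)
  have g1 := G.minDegree_le_degree (p 0)
  have g2 := G.minDegree_le_degree (p (S.card - 1))
  simp only [card_empty] at this
  omega

theorem exists_long_closed_path (hV : 3 ≤ Fintype.card V)
    (hδ : Fintype.card V ≤ 2 * G.minDegree + 2)
    (hconn : ¬ ConnectivityAtMostOne G) {a b : V} (h : PathOn G.Adj a b univ) :
    ∃ N, Fintype.card V ≤ N + 2 ∧ N ≤ Fintype.card V ∧ HasClosedPath G N := by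
  by_contra! hcon
  obtain ⟨p, h1, h2, h3, -, -, -⟩ := h.exists_enum
  rw [card_univ] at h1 h2 h3
  set n := Fintype.card V with hn
  have hno : ∀ a b S, PathOn (fun i j => G.Adj (p i) (p j)) a b S → S ⊆ range n →
      n - 2 ≤ S.card → ¬ G.Adj (p b) (p a) := by
    intro a b S h hsub hcard hba
    have hinj := h2.mono (show (S : Set ℕ) ⊆ range n by exact_mod_cast hsub)
    have := card_le_card hsub
    rw [card_range] at this
    exact hcon S.card (by omega) this
      ⟨_, _, _, h.map (R := G.Adj) hinj, hba, card_image_of_injOn hinj⟩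
  refine false_of_no_long_closed_path (n := n) (R := fun i j => G.Adj (p i) (p j))
    (fun _ _ => Adj.symm) h1 hno hV ?_ ?_
  · intro i j hi hj hi0 hi1 hj0 hj1
    by_contra hij
    have := sum_degrees_add_card_le h1 hno (by omega) (by simp [h3]) (by simp [h3])
      (M := {i, j}) (by simp [hi, hj, hi0, hi1, hj0, hj1])
    rw [card_pair hij] at this
    have g1 := G.minDegree_le_degree (p 0)
    have g2 := G.minDegree_le_degree (p (n - 1))
    omega
  · intro s hs1 hs2
    have hmem : ∀ i < n, ∀ j < n, p i = p j → i = j := fun i hi j hj =>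
      h2 (by simpa using hi) (by simpa using hj)
    obtain ⟨u, v, hu, hus, hv, hvs, huv⟩ := exists_adj_of_not_connectivityAtMostOne hconn
      (S := {p s}) (by simp) (A := {w | ∃ i < s, p i = w}) (a := p 0) (b := p (n - 1))
      ⟨0, hs1, rfl⟩
      (fun h => by have := hmem 0 (by omega) s (by omega) h; omega)
      (by
        rintro ⟨i, hi, h⟩
        have := hmem i (by omega) (n - 1) (by omega) h
        omega)
      (fun h => by have := hmem (n - 1) (by omega) s (by omega) h; omega)
    obtain ⟨i, hi, rfl⟩ := hu
    obtain ⟨j, hj, rfl⟩ := mem_image.mp (h3 ▸ mem_univ v)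
    refine ⟨i, j, hi, ?_, by simpa using hj, huv⟩
    by_contra hle
    rcases Nat.lt_or_ge j s with h | h
    · exact hv ⟨j, h, rfl⟩
    · exact hvs (by simp [show j = s by omega])

/-- An independent set of size `2 * m + 1` would be completely joined to its complement, which would
then be a union of parts of size two, although it has odd size. -/
theorem indep_card_le_half {m : ℕ} (hV : Fintype.card V = 4 * m)
    (hδ : 2 * m ≤ G.minDegree + 1) (hm : 0 < m) (hG : IsBalancedKPartite G (2 * m)) {s : Finset V}
    (hs : ∀ u ∈ s, ∀ v ∈ s, u ≠ v → ¬ G.Adj u v) : s.card ≤ 2 * m := by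
  obtain ⟨P, hP1, hP2⟩ := hG
  have hfib : Fintype.card V / (2 * m) = 2 := by
    rw [hV, show 4 * m = 2 * (2 * m) by ring, Nat.mul_div_cancel _ (by omega)]
  rw [hfib] at hP1
  have hnb : ∀ v ∈ s, G.neighborFinset v ⊆ sᶜ := by
    intro v hv w hw
    rw [mem_compl]
    rw [G.mem_neighborFinset] at hw
    exact fun hws => hs v hv w hws hw.ne hw
  have hdeg : ∀ v ∈ s, 2 * m ≤ (G.neighborFinset v).card + 1 := by
    intro v hv
    have := G.minDegree_le_degree v
    rw [G.card_neighborFinset_eq_degree]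
    omega
  by_contra! hlt
  have hcompl := card_compl_add_card s
  obtain ⟨v₀, hv₀⟩ : s.Nonempty := card_pos.mp (by omega)
  have hle := card_le_card (hnb v₀ hv₀)
  have hd₀ := hdeg v₀ hv₀
  have hall : ∀ v ∈ s, ∀ w ∉ s, G.Adj v w := by
    intro v hv w hw
    have h1 := hdeg v hv
    have := eq_of_subset_of_card_le (hnb v hv) (by omega)
    rw [← G.mem_neighborFinset, this, mem_compl]
    exact hw
  have hfiber : ∀ i ∈ sᶜ.image P, (sᶜ.filter fun v => P v = i).card = 2 := by
    intro i hi
    obtain ⟨w, hw, rfl⟩ := mem_image.mp hi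
    refine Eq.trans (congrArg card ?_) (hP1 (P w))
    ext v
    simp only [mem_filter, mem_univ, true_and, and_iff_right_iff_imp, mem_compl]
    exact fun h hv => hP2 v w (hall v hv w (mem_compl.mp hw)) h
  have hsum := card_eq_sum_card_image P sᶜ
  rw [sum_congr rfl hfiber, sum_const, smul_eq_mul] at hsum
  omega

theorem exists_large_indep {m : ℕ} (hm : 2 ≤ m) (hV : Fintype.card V = 4 * m)
    (hδ : 2 * m ≤ G.minDegree + 1) (hconn : ¬ ConnectivityAtMostOne G)
    (hham : ¬ G.IsHamiltonian) :
    ∃ s : Finset V, (2 * m ≤ s.card ∨ m = 2 ∧ 3 ≤ s.card) ∧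
      ∀ u ∈ s, ∀ v ∈ s, u ≠ v → ¬ G.Adj u v := by
  have hdeg : ∀ v, 2 * m ≤ G.degree v + 1 := fun v => by
    have := G.minDegree_le_degree v
    omega
  have hclosed : ¬ HasClosedPath G (4 * m) := fun h =>
    hham (HasClosedPath.isHamiltonian (by omega) (hV ▸ h))
  have hne : Nonempty V := Fintype.card_pos_iff.mp (by omega)
  obtain ⟨N, a, b, S, hS, rfl, hN, hmax⟩ := exists_longest_path (by omega) hconn
  have hSc := card_compl_add_card S
  by_cases hSu : S = univ
  · subst hSu
    obtain ⟨N, hN1, hN2, hc⟩ := exists_long_closed_path (by omega) (by omega) hconn hS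
    have hN3 : N ≠ 4 * m := by rintro rfl; exact hclosed hc
    have hoff : ∀ {N}, HasClosedPath G N → ∃ c : ℕ → V, ∃ T : Finset V, IsCyclicEnum G N c ∧
        Tᶜ.card = N ∧ (∀ z ∈ T, ∀ i, z ≠ c i) ∧ ∀ w, w ∈ (range N).image c ∨ w ∈ T := by
      rintro _ ⟨a, b, S', h, hba, rfl⟩
      obtain ⟨c, hc, hcS⟩ := h.exists_isCyclicEnum hba
      have hpos : 0 < S'.card := by
        obtain ⟨_, _, _, _, _, _, h6⟩ := h.exists_enum
        exact h6
      refine ⟨c, S'ᶜ, hc, by simp, ?_, fun w => ?_⟩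
      · rintro z hz i rfl
        obtain ⟨j, -, h2, h3⟩ := hc.exists_eq_of_pos hpos 0 i
        refine (mem_compl.mp hz) ?_
        rw [← h3, ← hcS]
        exact mem_image_of_mem _ (by simpa using h2)
      · rw [hcS, mem_compl]
        exact em _
    by_cases hc1 : HasClosedPath G (4 * m - 1)
    · obtain ⟨c, T, hcyc, hT, hTc, hcov⟩ := hoff hc1
      have hTcard := card_compl_add_card T
      obtain ⟨z, rfl⟩ := card_eq_one.mp (show T.card = 1 by omega)
      obtain ⟨s, hs1, hs2⟩ := hcyc.exists_indep (hTc z (by simp))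
        (by rwa [show 4 * m - 1 + 1 = 4 * m by omega])
      refine ⟨s, Or.inl ?_, hs2⟩
      have := degree_le_card_filter_add (G := G) (v := z) (p := c) (W := range (4 * m - 1))
        (T := ∅) fun w hw => Or.inl ((hcov w).resolve_right (by simpa using hw.ne'))
      have := hdeg z
      simp only [card_empty] at *
      omega
    · have hN4 : N ≠ 4 * m - 1 := by rintro rfl; exact hc1 hc
      obtain rfl : N = 4 * m - 2 := by omega
      obtain ⟨c, T, hcyc, hT, hTc, hcov⟩ := hoff hc
      have hTcard := card_compl_add_card T
      obtain ⟨x, y, hxy, rfl⟩ := card_eq_two.mp (show T.card = 2 by omega)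
      have hx := hTc x (by simp)
      have hy := hTc y (by simp)
      have hno1 : ¬ HasClosedPath G (4 * m - 2 + 1) := by
        rwa [show 4 * m - 2 + 1 = 4 * m - 1 by omega]
      have hno2 : ¬ HasClosedPath G (4 * m - 2 + 2) := by
        rwa [show 4 * m - 2 + 2 = 4 * m by omega]
      obtain ⟨s, hs1, hs2⟩ := hcyc.exists_indep hx hno1
      refine ⟨s, ?_, hs2⟩
      have hdx := hdeg x
      have hdy := hdeg y
      by_cases hadj : G.Adj x y
      · have g1 := degree_le_card_filter_add (G := G) (v := x) (p := c) (W := range (4 * m - 2))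
          (T := {y}) fun w hw => (hcov w).imp_right fun h => by
            simpa [hw.ne'] using h
        have g2 := degree_le_card_filter_add (G := G) (v := y) (p := c) (W := range (4 * m - 2))
          (T := {x}) fun w hw => (hcov w).imp_right fun h => by
            simpa [hw.ne'] using h
        have g3 := hcyc.card_filter_add_le (by omega) hx hy hadj hno1 hno2
        simp only [card_singleton] at g1 g2
        omega
      · have g1 := degree_le_card_filter_add (G := G) (v := x) (p := c) (W := range (4 * m - 2))
          (T := ∅) fun w hw => Or.inl ((hcov w).resolve_right fun h => by
            rcases mem_insert.mp h with rfl | h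
            · exact hw.ne rfl
            · exact hadj (mem_singleton.mp h ▸ hw))
        simp only [card_empty] at g1
        omega
  · have hpos : 0 < Sᶜ.card := card_pos.mpr (by simpa [nonempty_iff_ne_empty] using hSu)
    obtain ⟨z, hz⟩ := card_eq_one.mp (show Sᶜ.card = 1 by omega)
    have hzS : z ∉ S := mem_compl.mp (hz ▸ mem_singleton_self z)
    obtain ⟨p, h1, h2, h3, -, -, h6⟩ := hS.exists_enum
    obtain ⟨s, hs1, hs2⟩ := exists_indep_of_path h1 h2 h6 (z := z)
      (by
        rintro i hi rfl
        rw [← h3] at hzS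
        exact hzS (mem_image_of_mem _ (mem_range.mpr hi))) hmax
    refine ⟨s, Or.inl ?_, hs2⟩
    have := degree_le_card_filter_add (G := G) (v := z) (p := p) (W := range S.card) (T := ∅)
      fun w hw => Or.inl (by
        rw [h3]
        by_contra hwS
        have : w ∈ Sᶜ := mem_compl.mpr hwS
        rw [hz, mem_singleton] at this
        exact hw.ne' this)
    have := hdeg z
    simp only [card_empty] at *
    omega

end LongPaths

/-- **Proposition (characterization for `k = n/2`).**  Let `n ≥ 8` be divisible by `4`, let
`k = n/2`, and let `G` be a balanced `k`-partite graph on `n` vertices with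
`δ(G) ≥ n/2 − 1`.  If `G` has no Hamiltonian cycle, then `κ(G) ≤ 1`, or `n = 8` and
`α(G) = 3`, or `α(G) = n/2`. -/
theorem n_eq_two_k_characterization
    {V : Type*} [Fintype V] [DecidableEq V] (G : SimpleGraph V) [DecidableRel G.Adj]
    (n : ℕ) (hn : 8 ≤ n) (hdvd : 4 ∣ n) (hcard : Fintype.card V = n)
    (hG : IsBalancedKPartite G (n / 2))
    (hδ : n / 2 - 1 ≤ G.minDegree)
    (hham : ¬ G.IsHamiltonian) :
    ConnectivityAtMostOne G ∨ (n = 8 ∧ HasIndepNum G 3) ∨ HasIndepNum G (n / 2) := by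
  obtain ⟨m, rfl⟩ := hdvd
  rw [show 4 * m / 2 = 2 * m by omega] at hG hδ ⊢
  by_cases hconn : ConnectivityAtMostOne G
  · exact Or.inl hconn
  have hle : ∀ s : Finset V, (∀ u ∈ s, ∀ v ∈ s, u ≠ v → ¬ G.Adj u v) → s.card ≤ 2 * m :=
    fun s hs => indep_card_le_half hcard (by omega) (by omega) hG hs
  by_cases hbig : ∃ s : Finset V, 2 * m ≤ s.card ∧ ∀ u ∈ s, ∀ v ∈ s, u ≠ v → ¬ G.Adj u v
  · obtain ⟨s, hs1, hs2⟩ := hbig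
    exact Or.inr (Or.inr ⟨⟨s, le_antisymm (hle s hs2) hs1, hs2⟩, hle⟩)
  · obtain ⟨s, hs1 | ⟨rfl, hs1⟩, hs2⟩ :=
      exists_large_indep (by omega) hcard (by omega) hconn hham
    · exact absurd ⟨s, hs1, hs2⟩ hbig
    · have hle3 : ∀ t : Finset V, (∀ u ∈ t, ∀ v ∈ t, u ≠ v → ¬ G.Adj u v) → t.card ≤ 3 := by
        intro t ht
        by_contra hlt
        exact hbig ⟨t, by omega, ht⟩
      exact Or.inr (Or.inl ⟨rfl, ⟨s, le_antisymm (hle3 s hs2) hs1, hs2⟩, hle3⟩)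
end
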